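/- arXiv:1609.07199 — 2 statements merged into one kernel-verified Lean document; each statement's English description precedes it below -/
import Mathlib

section
/- Let θ be a CPWL function, let x̄, v̄, Ψ, Λ(x̄) be as in the variational-system setting with v̄ ∈ Λ(x̄), and assume in addition that f is continuously differentiable around x̄ and Φ is twice continuously differentiable around x̄. Then v̄ is a noncritical multiplier if and only if the following semi-isolated calmness property holds: there are ε > 0, ℓ ≥ 0 and neighborhoods U of 0 ∈ ℝ^n and W of 0 ∈ ℝ^m such that for every (p₁,p₂) ∈ U × W and every (x,v) ∈ S(p₁,p₂) with ‖(x,v) − (x̄,v̄)‖ ≤ ε one has ‖x − x̄‖ + dist(v, Λ(x̄)) ≤ ℓ(‖p₁‖ + ‖p₂‖). -/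
open Filter Topology Set RealInnerProductSpace

noncomputable section

abbrev Ev (k : ℕ) := EuclideanSpace ℝ (Fin k)

/-- The Bouligand–Severi tangent cone to a set `s` at `x`. -/
def tcone {E : Type*} [NormedAddCommGroup E] [NormedSpace ℝ E] (s : Set E) (x : E) : Set E :=
  {w | ∃ (z : ℕ → E) (c : ℕ → ℝ), (∀ k, z k ∈ s) ∧ (∀ k, 0 ≤ c k) ∧
      Tendsto z atTop (𝓝 x) ∧ Tendsto (fun k => c k • (z k - x)) atTop (𝓝 w)}

/-- The data of a convex piecewise linear (CPWL) extended-real-valued function on `ℝ^m`: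
`θ(z) = max_i (⟨a i, z⟩ - al i)` on the polyhedron `dom θ = {z | ⟨d i, z⟩ ≤ be i ∀ i}`,
and `θ(z) = +∞` outside of it. -/
structure CPWL (m : ℕ) where
  l : ℕ
  p : ℕ
  hl : 0 < l
  a : Fin l → Ev m
  al : Fin l → ℝ
  d : Fin p → Ev m
  be : Fin p → ℝ
  dom_nonempty : ∃ z : Ev m, ∀ i, ⟪d i, z⟫ ≤ be i

namespace CPWL

variable {m : ℕ} (θ : CPWL m)

/-- The (polyhedral) domain of the CPWL function. -/
def dom : Set (Ev m) := {z | ∀ i, ⟪θ.d i, z⟫ ≤ θ.be i}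

/-- The real value `max_i (⟨a i, z⟩ - al i)` of the CPWL function (meaningful on its domain). -/
def val (z : Ev m) : ℝ := ⨆ i : Fin θ.l, (⟪θ.a i, z⟫ - θ.al i)

/-- The CPWL function as an extended-real-valued function. -/
def eval (z : Ev m) : EReal :=
  @ite _ (z ∈ θ.dom) (Classical.propDecidable _) ((θ.val z : ℝ) : EReal) ⊤

/-- The subdifferential (of convex analysis) of the CPWL function. -/
def subdiff (z : Ev m) : Set (Ev m) :=
  {v | z ∈ θ.dom ∧ ∀ z' ∈ θ.dom, ⟪v, z' - z⟫ ≤ θ.val z' - θ.val z}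

/-- Active indices `K(z)` of the max-representation. -/
def Kact (z : Ev m) : Set (Fin θ.l) := {i | θ.val z = ⟪θ.a i, z⟫ - θ.al i}

/-- Active indices `I(z)` of the domain constraints. -/
def Iact (z : Ev m) : Set (Fin θ.p) := {i | ⟪θ.d i, z⟫ = θ.be i}

/-- The critical cone `𝒦(z̄,v̄) = {w ∈ T(z̄; dom θ) : ⟨v̄,w⟩ = θ′(z̄;w)}`. -/
def crit (zb vb : Ev m) : Set (Ev m) :=
  {w | w ∈ tcone θ.dom zb ∧
    Tendsto (fun t : ℝ => (θ.val (zb + t • w) - θ.val zb) / t) (𝓝[>] (0 : ℝ))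
      (𝓝 ⟪vb, w⟫)}

/-- The graph of the subdifferential mapping. -/
def gph : Set (Ev m × Ev m) := {zv | zv.2 ∈ θ.subdiff zv.1}

/-- The graphical derivative `(D∂θ)(z̄,v̄)(u)`. -/
def Dsub (zb vb u : Ev m) : Set (Ev m) := {w | (u, w) ∈ tcone θ.gph (zb, vb)}

/-- The regular coderivative `(D̂*∂θ)(z̄,v̄)(u)`. -/
def Dhat (zb vb u : Ev m) : Set (Ev m) :=
  {w | ∀ h ∈ tcone θ.gph (zb, vb), ⟪w, h.1⟫ - ⟪u, h.2⟫ ≤ 0}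

end CPWL

section VarSys

variable {n m : ℕ}

/-- The adjoint `∇Φ(x)*` of the Jacobian of `Φ` at `x`. -/
def adjD (Φ : Ev n → Ev m) (x : Ev n) : Ev m →L[ℝ] Ev n :=
  ContinuousLinearMap.adjoint (fderiv ℝ Φ x)

/-- `Ψ(x,v) = f(x) + ∇Φ(x)* v`. -/
def Psi (f : Ev n → Ev n) (Φ : Ev n → Ev m) (x : Ev n) (v : Ev m) : Ev n :=
  f x + adjD Φ x v

/-- The partial Jacobian `∇ₓΨ(x̄,v̄)`. -/
def gradxPsi (f : Ev n → Ev n) (Φ : Ev n → Ev m) (xb : Ev n) (vb : Ev m) :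
    Ev n →L[ℝ] Ev n :=
  fderiv ℝ (fun x => Psi f Φ x vb) xb

/-- The Lagrange multiplier set `Λ(x̄)` of the variational system. -/
def Lam (f : Ev n → Ev n) (Φ : Ev n → Ev m) (θ : CPWL m) (xb : Ev n) : Set (Ev m) :=
  {v | Psi f Φ xb v = 0 ∧ v ∈ θ.subdiff (Φ xb)}

/-- `v̄` is a critical multiplier for the variational system. -/
def IsCritical (f : Ev n → Ev n) (Φ : Ev n → Ev m) (θ : CPWL m) (xb : Ev n) (vb : Ev m) :
    Prop :=
  ∃ ξ : Ev n, ξ ≠ 0 ∧ ∃ w ∈ θ.Dsub (Φ xb) vb (fderiv ℝ Φ xb ξ),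
    gradxPsi f Φ xb vb ξ + adjD Φ xb w = 0

/-- The solution map of the canonically perturbed variational system. -/
def Smap (f : Ev n → Ev n) (Φ : Ev n → Ev m) (θ : CPWL m) (p₁ : Ev n) (p₂ : Ev m) :
    Set (Ev n × Ev m) :=
  {xv | Psi f Φ xv.1 xv.2 = p₁ ∧ xv.2 ∈ θ.subdiff (Φ xv.1 + p₂)}

end VarSys

section General

variable {n m : ℕ}

/-- The subdifferential of a general extended-real-valued function. -/
def subdiffE (θ : Ev m → EReal) (z : Ev m) : Set (Ev m) :=
  {v | ∀ z', ((⟪v, z' - z⟫ : ℝ) : EReal) ≤ θ z' - θ z}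

/-- The graph of the subdifferential of a general extended-real-valued function. -/
def gphE (θ : Ev m → EReal) : Set (Ev m × Ev m) := {zv | zv.2 ∈ subdiffE θ zv.1}

/-- The graphical derivative of the subdifferential, general case. -/
def DsubE (θ : Ev m → EReal) (zb vb u : Ev m) : Set (Ev m) :=
  {w | (u, w) ∈ tcone (gphE θ) (zb, vb)}

/-- The Lagrange multiplier set, general case. -/
def LamE (f : Ev n → Ev n) (Φ : Ev n → Ev m) (θ : Ev m → EReal) (xb : Ev n) :
    Set (Ev m) :=
  {v | Psi f Φ xb v = 0 ∧ v ∈ subdiffE θ (Φ xb)}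

/-- The solution map of the canonically perturbed variational system, general case. -/
def SmapE (f : Ev n → Ev n) (Φ : Ev n → Ev m) (θ : Ev m → EReal) (p₁ : Ev n)
    (p₂ : Ev m) : Set (Ev n × Ev m) :=
  {xv | Psi f Φ xv.1 xv.2 = p₁ ∧ xv.2 ∈ subdiffE θ (Φ xv.1 + p₂)}

end General

section Composite

variable {n m : ℕ}

/-- The gradient `∇ₓL(·,v)` of the Lagrangian `L(x,v) = φ₀(x) + ⟨Φ(x),v⟩`. -/
def gradL (φ₀ : Ev n → ℝ) (Φ : Ev n → Ev m) (v : Ev m) (x : Ev n) : Ev n :=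
  gradient (fun y => φ₀ y + ⟪Φ y, v⟫) x

/-- The Hessian `∇²ₓₓL(x̄,v)` as a linear operator. -/
def HessOp (φ₀ : Ev n → ℝ) (Φ : Ev n → Ev m) (v : Ev m) (xb : Ev n) : Ev n →L[ℝ] Ev n :=
  fderiv ℝ (gradL φ₀ Φ v) xb

/-- The Lagrange multiplier set `Λ_com(x̄)` of the composite optimization problem. -/
def LamCom (φ₀ : Ev n → ℝ) (Φ : Ev n → Ev m) (θ : CPWL m) (xb : Ev n) : Set (Ev m) :=
  {v | gradient φ₀ xb + adjD Φ xb v = 0 ∧ v ∈ θ.subdiff (Φ xb)}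

/-- Criticality of a multiplier in the composite optimization setting. -/
def IsCriticalCom (φ₀ : Ev n → ℝ) (Φ : Ev n → Ev m) (θ : CPWL m) (xb : Ev n) (v : Ev m) :
    Prop :=
  ∃ ξ : Ev n, ξ ≠ 0 ∧ ∃ w ∈ θ.Dsub (Φ xb) v (fderiv ℝ Φ xb ξ),
    HessOp φ₀ Φ v xb ξ + adjD Φ xb w = 0

/-- The solution map of the canonically perturbed KKT system of composite optimization. -/
def SKKT (φ₀ : Ev n → ℝ) (Φ : Ev n → Ev m) (θ : CPWL m) (p₁ : Ev n) (p₂ : Ev m) :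
    Set (Ev n × Ev m) :=
  {xv | gradient φ₀ xv.1 + adjD Φ xv.1 xv.2 = p₁ ∧ xv.2 ∈ θ.subdiff (Φ xv.1 + p₂)}

/-- `x̄` is a local minimizer of `φ₀ + θ∘Φ`. -/
def LocalMin (φ₀ : Ev n → ℝ) (Φ : Ev n → Ev m) (θ : CPWL m) (xb : Ev n) : Prop :=
  ∃ U ∈ 𝓝 xb, ∀ x ∈ U,
    ((φ₀ xb : ℝ) : EReal) + θ.eval (Φ xb) ≤ ((φ₀ x : ℝ) : EReal) + θ.eval (Φ x)

end Composite

section Calmness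

variable {n m : ℕ}

/-- Isolated calmness of a solution map at `((0,0), q0)`. -/
def IsolCalm (S : Ev n × Ev m → Set (Ev n × Ev m)) (q0 : Ev n × Ev m) : Prop :=
  ∃ c : ℝ, 0 ≤ c ∧ ∃ U ∈ 𝓝 (0 : Ev n × Ev m), ∃ V ∈ 𝓝 q0,
    ∀ p ∈ U, ∀ q ∈ S p ∩ V, ‖q - q0‖ ≤ c * (‖p.1‖ + ‖p.2‖)

/-- Robust isolated calmness of a solution map at `((0,0), q0)`. -/
def RobustIsolCalm (S : Ev n × Ev m → Set (Ev n × Ev m)) (q0 : Ev n × Ev m) : Prop :=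
  ∃ c : ℝ, 0 ≤ c ∧ ∃ U ∈ 𝓝 (0 : Ev n × Ev m), ∃ V ∈ 𝓝 q0,
    (∀ p ∈ U, ∀ q ∈ S p ∩ V, ‖q - q0‖ ≤ c * (‖p.1‖ + ‖p.2‖)) ∧
    (∀ p ∈ U, (S p ∩ V).Nonempty)

/-- The Lipschitz-like (Aubin) property of a solution map around `((0,0), q0)`. -/
def LipschitzLike (S : Ev n × Ev m → Set (Ev n × Ev m)) (q0 : Ev n × Ev m) : Prop :=
  ∃ c : ℝ, 0 ≤ c ∧ ∃ U ∈ 𝓝 (0 : Ev n × Ev m), ∃ V ∈ 𝓝 q0,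
    ∀ p ∈ U, ∀ p' ∈ U, ∀ q ∈ S p ∩ V, ∃ q' ∈ S p', ‖q - q'‖ ≤ c * ‖p - p'‖

end Calmness

lemma hx_conf_const {J E : Type*} [Fintype J] [NormedAddCommGroup E] [NormedSpace ℝ E]
    (M : (J → ℝ) →L[ℝ] E) (σ : J → SignType)
    (hgood : ∀ κ : J → ℝ, M κ = 0 → (∀ i, 0 ≤ κ i * (σ i : ℝ)) → (∀ i, σ i = 0 → κ i = 0) → κ = 0) :
    ∃ c : ℝ, 0 ≤ c ∧ ∀ κ : J → ℝ, (∀ i, 0 ≤ κ i * (σ i : ℝ)) → (∀ i, σ i = 0 → κ i = 0) →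
      ‖κ‖ ≤ c * ‖M κ‖ := by
  classical
  set O : Set (J → ℝ) := {κ | (∀ i, 0 ≤ κ i * (σ i : ℝ)) ∧ (∀ i, σ i = 0 → κ i = 0)} with hO
  have hOc : IsClosed O := by
    have : O = (⋂ i, {κ : J → ℝ | 0 ≤ κ i * (σ i : ℝ)}) ∩ (⋂ i, {κ : J → ℝ | σ i = 0 → κ i = 0}) := by
      ext κ; simp [hO]
    rw [this]
    refine IsClosed.inter (isClosed_iInter fun i => ?_) (isClosed_iInter fun i => ?_)
    · exact isClosed_le continuous_const (by fun_prop)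
    · by_cases h : σ i = 0
      · simp only [h, true_imp_iff]
        exact isClosed_eq (by fun_prop) continuous_const
      · simp [h]
  have hK : IsCompact (O ∩ Metric.sphere (0 : J → ℝ) 1) := (isCompact_sphere _ _).inter_left hOc
  by_cases hne : (O ∩ Metric.sphere (0 : J → ℝ) 1).Nonempty
  · obtain ⟨κ0, hκ0, hmin⟩ := hK.exists_isMinOn hne (f := fun κ => ‖M κ‖) (by fun_prop)
    have hpos : 0 < ‖M κ0‖ := by
      rw [norm_pos_iff]
      intro h0
      have := hgood κ0 h0 hκ0.1.1 hκ0.1.2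
      have h1 := hκ0.2
      simp [this] at h1
    refine ⟨‖M κ0‖⁻¹, by positivity, fun κ h1 h2 => ?_⟩
    by_cases hk : κ = 0
    · simp [hk]
    have hkn : 0 < ‖κ‖ := norm_pos_iff.2 hk
    have hmem : ‖κ‖⁻¹ • κ ∈ O ∩ Metric.sphere (0 : J → ℝ) 1 := by
      refine ⟨⟨fun i => ?_, fun i hi => ?_⟩, ?_⟩
      · simp only [Pi.smul_apply, smul_eq_mul, mul_assoc]
        exact mul_nonneg (by positivity) (h1 i)
      · simp [h2 i hi]
      · simp [norm_smul, hkn.ne']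
    have := hmin hmem
    simp only [Set.mem_ofPred_eq, map_smul, norm_smul, norm_inv, norm_norm] at this
    rw [le_inv_mul_iff₀ hpos]
    rw [le_inv_mul_iff₀ hkn] at this
    linarith
  · refine ⟨0, le_rfl, fun κ h1 h2 => ?_⟩
    by_contra hcon
    have hk : κ ≠ 0 := by rintro rfl; simp at hcon
    have hkn : 0 < ‖κ‖ := norm_pos_iff.2 hk
    apply hne
    refine ⟨‖κ‖⁻¹ • κ, ⟨fun i => ?_, fun i hi => ?_⟩, ?_⟩
    · simp only [Pi.smul_apply, smul_eq_mul, mul_assoc]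
      exact mul_nonneg (by positivity) (h1 i)
    · simp [h2 i hi]
    · simp [norm_smul, hkn.ne']

/-- conformal Hoffman-type lemma -/
lemma hx_conf {J E : Type*} [Fintype J] [NormedAddCommGroup E] [NormedSpace ℝ E]
    (M : (J → ℝ) →L[ℝ] E) :
    ∃ c : ℝ, 0 ≤ c ∧ ∀ δ : J → ℝ, ∃ δ' : J → ℝ, (∀ i, δ' i ∈ uIcc 0 (δ i)) ∧ M δ' = M δ ∧
      ‖δ'‖ ≤ c * ‖M δ‖ := by
  classical
  have key : ∀ σ : J → SignType, ∃ c : ℝ, 0 ≤ c ∧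
      ((∀ κ : J → ℝ, M κ = 0 → (∀ i, 0 ≤ κ i * (σ i : ℝ)) → (∀ i, σ i = 0 → κ i = 0) → κ = 0) →
      ∀ κ : J → ℝ, (∀ i, 0 ≤ κ i * (σ i : ℝ)) → (∀ i, σ i = 0 → κ i = 0) →
      ‖κ‖ ≤ c * ‖M κ‖) := by
    intro σ
    by_cases h : (∀ κ : J → ℝ, M κ = 0 → (∀ i, 0 ≤ κ i * (σ i : ℝ)) → (∀ i, σ i = 0 → κ i = 0) → κ = 0)
    · obtain ⟨c, hc, H⟩ := hx_conf_const M σ h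
      exact ⟨c, hc, fun _ => H⟩
    · exact ⟨0, le_rfl, fun h' => absurd h' h⟩
  choose C hC0 hC using key
  refine ⟨∑ σ, C σ, Finset.sum_nonneg fun σ _ => hC0 σ, fun δ => ?_⟩
  have hcomp : IsCompact ((Set.univ.pi fun i => uIcc 0 (δ i)) ∩ {x | M x = M δ}) :=
    (isCompact_univ_pi fun i => isCompact_uIcc).inter_right
      (isClosed_eq (by fun_prop) continuous_const)
  obtain ⟨x, hx, hmin⟩ := hcomp.exists_isMinOn ⟨δ, by simp⟩ (f := fun x => ∑ i, |x i|)
    (by fun_prop)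
  have hxb : ∀ i, x i ∈ uIcc 0 (δ i) := fun i => hx.1 i trivial
  refine ⟨x, hxb, hx.2, ?_⟩
  rw [← hx.2]
  set σ : J → SignType := fun i => SignType.sign (x i) with hσ
  have hx1 : ∀ i, 0 ≤ x i * (σ i : ℝ) := fun i => by
    rw [hσ]; simp only [mul_comm (x i), sign_mul_self]; positivity
  have hx2 : ∀ i, σ i = 0 → x i = 0 := fun i hi => by simpa [hσ] using hi
  refine (hC σ ?_ x hx1 hx2).trans
    (mul_le_mul_of_nonneg_right (Finset.single_le_sum (fun σ _ => hC0 σ) (Finset.mem_univ σ))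
      (norm_nonneg _))
  intro κ hMκ hκ1 hκ2
  by_contra hne
  -- for small t, x - t κ is between 0 and x
  have hsm : ∀ i, ∀ᶠ t in 𝓝[>] (0:ℝ), 0 ≤ (x i - t * κ i) * (σ i : ℝ) := by
    intro i
    rcases eq_or_ne (x i) 0 with h0 | h0
    · have := hκ2 i (by simp [hσ, h0])
      simp [this, h0]
    · have hp : 0 < x i * (σ i : ℝ) := by
        rw [hσ]; simp only [mul_comm (x i), sign_mul_self]; positivity
      have : Tendsto (fun t : ℝ => (x i - t * κ i) * (σ i : ℝ)) (𝓝[>] 0) (𝓝 ((x i - 0 * κ i) * (σ i : ℝ))) := by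
        apply Tendsto.mono_left _ nhdsWithin_le_nhds
        exact Continuous.tendsto (by fun_prop) _
      rw [zero_mul, sub_zero] at this
      exact (this.eventually (lt_mem_nhds hp)).mono fun t ht => le_of_lt ht
  obtain ⟨t, ht, ht0⟩ := ((eventually_all.2 hsm).and self_mem_nhdsWithin).exists
  have ht0 : 0 < t := ht0
  have habs : ∀ i, |x i - t * κ i| ≤ |x i| ∧ (κ i ≠ 0 → |x i - t * κ i| < |x i|) ∧
      x i - t * κ i ∈ uIcc 0 (δ i) := by
    intro i
    have h1 := ht i
    have h2 := hκ1 i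
    have h3 := hxb i
    rcases lt_trichotomy (x i) 0 with h | h | h
    · simp only [hσ, sign_neg h, SignType.coe_neg, SignType.coe_one] at h1 h2
      have h4 : t * κ i ≤ 0 := mul_nonpos_of_nonneg_of_nonpos ht0.le (by linarith)
      rw [abs_of_nonpos (by linarith), abs_of_neg h]
      refine ⟨by linarith, fun hk => ?_, ?_⟩
      · have : t * κ i < 0 := mul_neg_of_pos_of_neg ht0 (lt_of_le_of_ne (by linarith) hk)
        linarith
      · rw [mem_uIcc] at h3 ⊢
        right; rcases h3 with h3 | h3 <;> constructor <;> linarith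
    · have := hκ2 i (by simp [hσ, h])
      simp [this, h]
    · simp only [hσ, sign_pos h, SignType.coe_one] at h1 h2
      have h4 : 0 ≤ t * κ i := mul_nonneg ht0.le (by linarith)
      rw [abs_of_nonneg (by linarith), abs_of_pos h]
      refine ⟨by linarith, fun hk => ?_, ?_⟩
      · have : 0 < t * κ i := mul_pos ht0 (lt_of_le_of_ne (by linarith) hk.symm)
        linarith
      · rw [mem_uIcc] at h3 ⊢
        left; rcases h3 with h3 | h3 <;> constructor <;> linarith
  have hmem : x - t • κ ∈ (Set.univ.pi fun i => uIcc 0 (δ i)) ∩ {x | M x = M δ} := by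
    refine ⟨fun i _ => (habs i).2.2, ?_⟩
    have := hx.2
    simp only [Set.mem_ofPred_eq] at this
    simp [hMκ, this]
  have hle := hmin hmem
  simp only [Set.mem_ofPred_eq] at hle
  obtain ⟨i, hi⟩ := Function.ne_iff.1 hne
  have : ∑ i, |(x - t • κ) i| < ∑ i, |x i| :=
    Finset.sum_lt_sum (fun i _ => (habs i).1) ⟨i, Finset.mem_univ i, (habs i).2.1 hi⟩
  linarith

/-- the cone generated with support in σ is closed -/
lemma hx_closed {J E : Type*} [Fintype J] [NormedAddCommGroup E] [NormedSpace ℝ E]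
    (M : (J → ℝ) →L[ℝ] E) (σ : Set J) :
    IsClosed (M '' {x | (∀ i, 0 ≤ x i) ∧ ∀ i ∉ σ, x i = 0}) := by
  classical
  obtain ⟨c, hc, H⟩ := hx_conf M
  have hS : IsClosed {x : J → ℝ | (∀ i, 0 ≤ x i) ∧ ∀ i ∉ σ, x i = 0} := by
    have : {x : J → ℝ | (∀ i, 0 ≤ x i) ∧ ∀ i ∉ σ, x i = 0} =
      (⋂ i, {x : J → ℝ | 0 ≤ x i}) ∩ (⋂ i, {x : J → ℝ | i ∉ σ → x i = 0}) := by
      ext κ; simp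
    rw [this]
    refine IsClosed.inter (isClosed_iInter fun i => ?_) (isClosed_iInter fun i => ?_)
    · exact isClosed_le continuous_const (by fun_prop)
    · by_cases h : i ∉ σ
      · simp only [h, not_false_eq_true, true_imp_iff]
        exact isClosed_eq (by fun_prop) continuous_const
      · simp [h]
  apply IsSeqClosed.isClosed
  intro q qb hq hlim
  choose y hy hyq using hq
  choose y' h1 h2 h3 using fun k => H (y k)
  have hy' : ∀ k, y' k ∈ {x : J → ℝ | (∀ i, 0 ≤ x i) ∧ ∀ i ∉ σ, x i = 0} := by
    intro k
    refine ⟨fun i => ?_, fun i hi => ?_⟩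
    · have := h1 k i
      rw [uIcc_of_le ((hy k).1 i)] at this
      exact this.1
    · have := h1 k i
      rw [(hy k).2 i hi] at this
      simpa using this
  obtain ⟨R, hR⟩ := hlim.norm.bddAbove_range
  have hbd : ∀ k, y' k ∈ Metric.closedBall (0 : J → ℝ) (c * R) := by
    intro k
    rw [mem_closedBall_zero_iff]
    refine (h3 k).trans (mul_le_mul_of_nonneg_left ?_ hc)
    rw [hyq]; exact hR ⟨k, rfl⟩
  obtain ⟨z, _, φ, hφ, hz⟩ := tendsto_subseq_of_bounded Metric.isBounded_closedBall hbd
  refine ⟨z, hS.mem_of_tendsto hz (Eventually.of_forall fun k => hy' _), ?_⟩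
  have e1 : Tendsto (fun k => M (y' (φ k))) atTop (𝓝 (M z)) := (M.continuous.tendsto _).comp hz
  have e2 : Tendsto (fun k => M (y' (φ k))) atTop (𝓝 qb) := by
    simp only [h2, hyq]
    exact hlim.comp hφ.tendsto_atTop
  exact tendsto_nhds_unique e1 e2

lemma hx_farkas {J E : Type*} [Fintype J] [NormedAddCommGroup E] [NormedSpace ℝ E]
    (M : (J → ℝ) →L[ℝ] E) (σ : Set J) (y : E)
    (hy : y ∉ M '' {x | (∀ i, 0 ≤ x i) ∧ ∀ i ∉ σ, x i = 0}) :
    ∃ g : E →L[ℝ] ℝ, 0 < g y ∧ ∀ x : J → ℝ, (∀ i, 0 ≤ x i) → (∀ i ∉ σ, x i = 0) → g (M x) ≤ 0 := by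
  have hcv : Convex ℝ (M '' {x | (∀ i, 0 ≤ x i) ∧ ∀ i ∉ σ, x i = 0}) := by
    apply Convex.linear_image (f := (M : (J → ℝ) →ₗ[ℝ] E))
    intro x hx y hy a b ha hb _
    refine ⟨fun i => ?_, fun i hi => ?_⟩
    · have := hx.1 i
      have := hy.1 i
      simp only [Pi.add_apply, Pi.smul_apply, smul_eq_mul]; positivity
    · simp [hx.2 i hi, hy.2 i hi]
  obtain ⟨g, u, h1, h2⟩ := geometric_hahn_banach_closed_point hcv (hx_closed M σ) hy
  have hu : 0 < u := by
    have := h1 0 ⟨0, by simp, by simp⟩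
    simpa using this
  refine ⟨g, hu.trans h2, fun x hx0 hxs => ?_⟩
  by_contra hcon
  push Not at hcon
  have := h1 (M ((u / g (M x)) • x)) ⟨_, ⟨fun i => ?_, fun i hi => ?_⟩, rfl⟩
  · simp only [map_smul, smul_eq_mul] at this
    rw [div_mul_cancel₀ _ hcon.ne'] at this
    exact lt_irrefl _ this
  · have := hx0 i
    simp only [Pi.smul_apply, smul_eq_mul]; positivity
  · simp [hxs i hi]

def hx_M1 {m : ℕ} (θ : CPWL m) : (Fin θ.l ⊕ Fin θ.p → ℝ) →L[ℝ] Ev m :=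
  ∑ j, (ContinuousLinearMap.proj (R := ℝ) (φ := fun _ : Fin θ.l ⊕ Fin θ.p => ℝ) j).smulRight
    (Sum.elim θ.a θ.d j)

def hx_M2 {m : ℕ} (θ : CPWL m) : (Fin θ.l ⊕ Fin θ.p → ℝ) →L[ℝ] ℝ :=
  ∑ i : Fin θ.l, ContinuousLinearMap.proj (R := ℝ) (φ := fun _ : Fin θ.l ⊕ Fin θ.p => ℝ) (Sum.inl i)

lemma hx_M1_apply {m : ℕ} (θ : CPWL m) (x : Fin θ.l ⊕ Fin θ.p → ℝ) :
    hx_M1 θ x = ∑ i, x (Sum.inl i) • θ.a i + ∑ j, x (Sum.inr j) • θ.d j := by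
  simp [hx_M1]

lemma hx_M2_apply {m : ℕ} (θ : CPWL m) (x : Fin θ.l ⊕ Fin θ.p → ℝ) :
    hx_M2 θ x = ∑ i, x (Sum.inl i) := by
  simp [hx_M2]

def hx_act {m : ℕ} (θ : CPWL m) (z : Ev m) : Set (Fin θ.l ⊕ Fin θ.p) :=
  {j | Sum.elim (fun i => i ∈ θ.Kact z) (fun i => i ∈ θ.Iact z) j}

lemma hx_le_val {m : ℕ} (θ : CPWL m) (z : Ev m) (i : Fin θ.l) :
    ⟪θ.a i, z⟫ - θ.al i ≤ θ.val z :=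
  le_ciSup (f := fun i : Fin θ.l => (⟪θ.a i, z⟫ - θ.al i)) (Set.finite_range _).bddAbove i

lemma hx_val_le {m : ℕ} (θ : CPWL m) (z : Ev m) (r : ℝ) (h : ∀ i, ⟪θ.a i, z⟫ - θ.al i ≤ r) :
    θ.val z ≤ r := by
  have : Nonempty (Fin θ.l) := ⟨⟨0, θ.hl⟩⟩
  exact ciSup_le h

lemma hx_mem_of_rep {m : ℕ} (θ : CPWL m) (z : Ev m) (hz : z ∈ θ.dom)
    (x : Fin θ.l ⊕ Fin θ.p → ℝ) (h0 : ∀ i, 0 ≤ x i) (hs : ∀ i ∉ hx_act θ z, x i = 0)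
    (h1 : hx_M2 θ x = 1) : hx_M1 θ x ∈ θ.subdiff z := by
  refine ⟨hz, fun z' hz' => ?_⟩
  rw [hx_M2_apply] at h1
  rw [hx_M1_apply, inner_add_left, sum_inner, sum_inner]
  simp only [inner_smul_left, conj_trivial]
  have e1 : ∑ i, x (Sum.inl i) * ⟪θ.a i, z' - z⟫ ≤ ∑ i, x (Sum.inl i) * (θ.val z' - θ.val z) := by
    refine Finset.sum_le_sum fun i _ => ?_
    by_cases hi : i ∈ θ.Kact z
    · refine mul_le_mul_of_nonneg_left ?_ (h0 _)
      have hi : θ.val z = ⟪θ.a i, z⟫ - θ.al i := hi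
      rw [inner_sub_right]
      have := hx_le_val θ z' i
      linarith
    · rw [hs (Sum.inl i) hi]; simp
  have e2 : ∑ j, x (Sum.inr j) * ⟪θ.d j, z' - z⟫ ≤ 0 := by
    refine Finset.sum_nonpos fun j _ => ?_
    by_cases hj : j ∈ θ.Iact z
    · refine mul_nonpos_of_nonneg_of_nonpos (h0 _) ?_
      have hj : ⟪θ.d j, z⟫ = θ.be j := hj
      rw [inner_sub_right, hj]
      have := hz' j
      linarith
    · rw [hs (Sum.inr j) hj]; simp
  rw [← Finset.sum_mul, h1] at e1
  linarith

lemma hx_rep {m : ℕ} (θ : CPWL m) (z v : Ev m) (hv : v ∈ θ.subdiff z) :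
    ∃ x : Fin θ.l ⊕ Fin θ.p → ℝ, (∀ i, 0 ≤ x i) ∧ (∀ i ∉ hx_act θ z, x i = 0) ∧
      hx_M2 θ x = 1 ∧ hx_M1 θ x = v := by
  classical
  by_contra hcon
  have hn : (v, (1:ℝ)) ∉ ((hx_M1 θ).prod (hx_M2 θ)) ''
      {x | (∀ i, 0 ≤ x i) ∧ ∀ i ∉ hx_act θ z, x i = 0} := by
    rintro ⟨x, ⟨hx0, hxs⟩, hx⟩
    simp only [ContinuousLinearMap.prod_apply, Prod.mk.injEq] at hx
    exact hcon ⟨x, hx0, hxs, hx.2, hx.1⟩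
  obtain ⟨g, hg1, hg2⟩ := hx_farkas _ _ _ hn
  set r := g (0, 1) with hr
  set w : Ev m := (InnerProductSpace.toDual ℝ (Ev m)).symm
    (g.comp (ContinuousLinearMap.inl ℝ (Ev m) ℝ)) with hw
  have hgw : ∀ (y : Ev m) (s : ℝ), g (y, s) = ⟪w, y⟫ + s * r := by
    intro y s
    have : ((y, s) : Ev m × ℝ) = (y, 0) + s • ((0 : Ev m), (1:ℝ)) := by simp
    rw [this, map_add, map_smul, smul_eq_mul, hw, InnerProductSpace.toDual_symm_apply]
    simp [hr]
  rw [hgw] at hg1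
  have hK : ∀ i ∈ θ.Kact z, ⟪θ.a i, w⟫ + r ≤ 0 := by
    intro i hi
    have := hg2 (Pi.single (Sum.inl i) 1)
      (fun j => by by_cases h : j = Sum.inl i <;> simp [h])
      (fun j hj => by
        rw [Pi.single_apply, if_neg]
        rintro rfl; exact hj hi)
    rw [ContinuousLinearMap.prod_apply, hgw, hx_M1_apply, hx_M2_apply] at this
    simp [Pi.single_apply] at this
    rw [real_inner_comm]; linarith
  have hI : ∀ i ∈ θ.Iact z, ⟪θ.d i, w⟫ ≤ 0 := by
    intro i hi
    have := hg2 (Pi.single (Sum.inr i) 1)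
      (fun j => by by_cases h : j = Sum.inr i <;> simp [h])
      (fun j hj => by
        rw [Pi.single_apply, if_neg]
        rintro rfl; exact hj hi)
    rw [ContinuousLinearMap.prod_apply, hgw, hx_M1_apply, hx_M2_apply] at this
    simp [Pi.single_apply] at this
    rw [real_inner_comm]; linarith
  have hlim : ∀ (y : Ev m) (s : ℝ), Tendsto (fun t : ℝ => ⟪y, z + t • w⟫ + t * s) (𝓝[>] 0) (𝓝 ⟪y, z⟫) := by
    intro y s
    have : Tendsto (fun t : ℝ => ⟪y, z + t • w⟫ + t * s) (𝓝[>] 0) (𝓝 (⟪y, z + (0:ℝ) • w⟫ + 0 * s)) := by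
      apply Tendsto.mono_left _ nhdsWithin_le_nhds
      exact Continuous.tendsto (by fun_prop) _
    simpa using this
  have hdom : ∀ i, ∀ᶠ t in 𝓝[>] (0:ℝ), ⟪θ.d i, z + t • w⟫ ≤ θ.be i := by
    intro i
    by_cases hi : i ∈ θ.Iact z
    · filter_upwards [self_mem_nhdsWithin] with t ht
      have ht : 0 < t := ht
      have h1 : ⟪θ.d i, z⟫ = θ.be i := hi
      rw [inner_add_right, inner_smul_right, h1]
      have := mul_nonpos_of_nonneg_of_nonpos ht.le (hI i hi)
      linarith
    · have h1 : ⟪θ.d i, z⟫ < θ.be i := lt_of_le_of_ne (hv.1 i) hi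
      filter_upwards [(hlim (θ.d i) 0).eventually (gt_mem_nhds h1)] with t ht
      simp at ht; exact ht.le
  have hval : ∀ i, ∀ᶠ t in 𝓝[>] (0:ℝ), ⟪θ.a i, z + t • w⟫ - θ.al i ≤ θ.val z - t * r := by
    intro i
    by_cases hi : i ∈ θ.Kact z
    · filter_upwards [self_mem_nhdsWithin] with t ht
      have ht : 0 < t := ht
      have h1 : θ.val z = ⟪θ.a i, z⟫ - θ.al i := hi
      rw [inner_add_right, inner_smul_right, h1]
      have := mul_nonpos_of_nonneg_of_nonpos ht.le (hK i hi)
      linarith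
    · have h1 : ⟪θ.a i, z⟫ < θ.val z + θ.al i := by
        have := lt_of_le_of_ne (hx_le_val θ z i) (fun h => hi h.symm)
        linarith
      filter_upwards [(hlim (θ.a i) r).eventually (gt_mem_nhds h1)] with t ht
      linarith
  obtain ⟨t, ⟨h1, h2⟩, h3⟩ := (((eventually_all.2 hdom).and (eventually_all.2 hval)).and
    self_mem_nhdsWithin).exists
  have h3 : 0 < t := h3
  have h4 := hv.2 (z + t • w) h1
  have h5 := hx_val_le θ _ _ h2
  rw [add_sub_cancel_left, inner_smul_right, real_inner_comm] at h4
  have : 0 < t * (⟪w, v⟫ + 1 * r) := mul_pos h3 hg1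
  linarith

lemma hx_val_cont {m : ℕ} (θ : CPWL m) {z : ℕ → Ev m} {zb : Ev m} (hz : Tendsto z atTop (𝓝 zb))
    (i : Fin θ.l) (h : ∀ k, i ∈ θ.Kact (z k)) : i ∈ θ.Kact zb := by
  apply le_antisymm _ (hx_le_val θ zb i)
  refine hx_val_le θ _ _ fun j => ?_
  have t1 : ∀ j, Tendsto (fun k => ⟪θ.a j, z k⟫ - θ.al j) atTop (𝓝 (⟪θ.a j, zb⟫ - θ.al j)) := by
    intro j
    exact (tendsto_const_nhds.inner hz).sub tendsto_const_nhds
  refine le_of_tendsto_of_tendsto' (t1 j) (t1 i) fun k => ?_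
  have h1 : θ.val (z k) = ⟪θ.a i, z k⟫ - θ.al i := h k
  rw [← h1]; exact hx_le_val θ _ j

/-- structural lemma -/
lemma hx_struct {n m : ℕ} (θ : CPWL m) (A : Ev m →L[ℝ] Ev n) (z v : ℕ → Ev m) (zb vb : Ev m)
    (hz : Tendsto z atTop (𝓝 zb)) (hv : Tendsto v atTop (𝓝 vb))
    (hzv : ∀ k, v k ∈ θ.subdiff (z k)) :
    ∃ c : ℝ, 0 ≤ c ∧ ∃ φ : ℕ → ℕ, StrictMono φ ∧ ∃ e : ℕ → Ev m, ∀ k,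
      A (e k) = A (v (φ k) - vb) ∧ ‖e k‖ ≤ c * ‖A (v (φ k) - vb)‖ ∧
      vb + e k ∈ θ.subdiff (z (φ k)) ∧ v (φ k) - e k ∈ θ.subdiff zb := by
  classical
  obtain ⟨σ, hσ⟩ := Finite.exists_infinite_fiber (fun k => hx_act θ (z k))
  have hfr : ∃ᶠ k in atTop, hx_act θ (z k) = σ := by
    rw [Nat.frequently_atTop_iff_infinite]
    exact Set.infinite_coe_iff.1 hσ
  obtain ⟨φ, hφ, hact⟩ := extraction_of_frequently_atTop hfr
  choose x hx0 hxs hx2 hx1 using fun k => hx_rep θ (z (φ k)) (v (φ k)) (hzv _)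
  simp only [hact] at hxs
  have hzφ := hz.comp hφ.tendsto_atTop
  have hvφ := hv.comp hφ.tendsto_atTop
  -- representation of vb
  obtain ⟨xb, ⟨hb0, hbs⟩, hbM⟩ : (vb, (1:ℝ)) ∈ ((hx_M1 θ).prod (hx_M2 θ)) ''
      {x | (∀ i, 0 ≤ x i) ∧ ∀ i ∉ σ, x i = 0} := by
    refine (hx_closed _ σ).mem_of_tendsto (hvφ.prodMk_nhds tendsto_const_nhds)
      (Eventually.of_forall fun k => ⟨x k, ⟨hx0 k, hxs k⟩, ?_⟩)
    simp [hx1, hx2]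
  simp only [ContinuousLinearMap.prod_apply, Prod.mk.injEq] at hbM
  have hzbdom : zb ∈ θ.dom := by
    intro i
    exact le_of_tendsto (tendsto_const_nhds.inner hz) (Eventually.of_forall fun k => (hzv k).1 i)
  have hsub : σ ⊆ hx_act θ zb := by
    rintro (i | i) hi
    · exact hx_val_cont θ hzφ i (fun k => by
        have : Sum.inl i ∈ hx_act θ (z (φ k)) := by rw [hact]; exact hi
        exact this)
    · have : ∀ k, ⟪θ.d i, z (φ k)⟫ = θ.be i := fun k => by
        have : Sum.inr i ∈ hx_act θ (z (φ k)) := by rw [hact]; exact hi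
        exact this
      have t1 : Tendsto (fun k => ⟪θ.d i, z (φ k)⟫) atTop (𝓝 ⟪θ.d i, zb⟫) :=
        tendsto_const_nhds.inner hzφ
      simp only [this] at t1
      exact (tendsto_nhds_unique t1 tendsto_const_nhds)
  obtain ⟨c, hc, H⟩ := hx_conf ((A.comp (hx_M1 θ)).prod (hx_M2 θ))
  choose δ hδ1 hδ2 hδ3 using fun k => H (x k - xb)
  simp only [ContinuousLinearMap.prod_apply, Prod.mk.injEq, ContinuousLinearMap.comp_apply, map_sub,
    Prod.mk_sub_mk, hx1, hx2, hbM, sub_self] at hδ2 hδ3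
  have hbet : ∀ k i, 0 ≤ xb i + δ k i ∧ 0 ≤ x k i - δ k i := by
    intro k i
    have h1 := hδ1 k i
    have h2 := hx0 k i
    have h3 := hb0 i
    rw [mem_uIcc] at h1
    simp only [Pi.sub_apply] at h1
    rcases h1 with h1 | h1 <;> constructor <;> linarith
  have hδs : ∀ k, ∀ i ∉ σ, δ k i = 0 := by
    intro k i hi
    have h1 := hδ1 k i
    rw [Pi.sub_apply, hxs k i hi, hbs i hi] at h1
    simpa using h1
  refine ⟨‖hx_M1 θ‖ * c, by positivity, φ, hφ, fun k => hx_M1 θ (δ k), fun k => ⟨?_, ?_, ?_, ?_⟩⟩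
  · rw [(hδ2 k).1, map_sub]
  · refine ((hx_M1 θ).le_opNorm _).trans ?_
    rw [mul_assoc]
    refine mul_le_mul_of_nonneg_left ((hδ3 k).trans ?_) (norm_nonneg _)
    refine mul_le_mul_of_nonneg_left ?_ hc
    rw [map_sub]
    simp [Prod.norm_def]
  · have := hx_mem_of_rep θ (z (φ k)) (hzv _).1 (xb + δ k) (fun i => (hbet k i).1)
      (fun i hi => by rw [hact] at hi; simp [hbs i hi, hδs k i hi])
      (by rw [map_add, hbM.2, (hδ2 k).2, add_zero])
    rwa [map_add, hbM.1] at this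
  · have := hx_mem_of_rep θ zb hzbdom (x k - δ k) (fun i => (hbet k i).2)
      (fun i hi => by
        have hi : i ∉ σ := fun h => hi (hsub h)
        simp [hxs k i hi, hδs k i hi])
      (by rw [map_sub, hx2, (hδ2 k).2, sub_zero])
    rwa [map_sub, hx1] at this

lemma hx_seq_lim {E F : Type*} [NormedAddCommGroup E] [NormedSpace ℝ E]
    [NormedAddCommGroup F] [NormedSpace ℝ F] {g : E → F} {g' : E →L[ℝ] F} {xb : E}
    (hg : HasFDerivAt g g' xb) {x : ℕ → E} {c : ℕ → ℝ} {ξ : E} (hx : Tendsto x atTop (𝓝 xb))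
    (hc : Tendsto (fun k => c k • (x k - xb)) atTop (𝓝 ξ)) :
    Tendsto (fun k => c k • (g (x k) - g xb)) atTop (𝓝 (g' ξ)) := by
  have h0 : Tendsto (fun k => x k - xb) atTop (𝓝 0) := by
    simpa using hx.sub (tendsto_const_nhds (x := xb))
  have := (hasFDerivWithinAt_univ.2 hg).lim h0 (Eventually.of_forall fun _ => mem_univ _) hc
  simpa using this

def hx_adj (n m : ℕ) : (Ev n →L[ℝ] Ev m) →L[ℝ] (Ev m →L[ℝ] Ev n) :=
  LinearMap.toContinuousLinearMap
    { toFun := fun T => ContinuousLinearMap.adjoint T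
      map_add' := fun a b => map_add _ a b
      map_smul' := fun r a => by simp }

lemma hx_psi_lim {n m : ℕ} {f : Ev n → Ev n} {Φ : Ev n → Ev m}
    {xb : Ev n} {vb : Ev m}
    (hf : ContDiffAt ℝ 1 f xb) (hPhi : ContDiffAt ℝ 2 Φ xb)
    {x : ℕ → Ev n} {v : ℕ → Ev m} {c : ℕ → ℝ} {ξ : Ev n}
    (hx : Tendsto x atTop (𝓝 xb)) (hv : Tendsto v atTop (𝓝 vb))
    (hc : Tendsto (fun k => c k • (x k - xb)) atTop (𝓝 ξ)) :
    Tendsto (fun k => c k • (Psi f Φ (x k) (v k) - Psi f Φ xb (v k))) atTop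
      (𝓝 (gradxPsi f Φ xb vb ξ)) := by
  have hf' : HasFDerivAt f (fderiv ℝ f xb) xb := (hf.differentiableAt (by norm_num)).hasFDerivAt
  have hd : DifferentiableAt ℝ (fderiv ℝ Φ) xb :=
    (hPhi.fderiv_right (m := 1) (by norm_num)).differentiableAt (by norm_num)
  have hA : HasFDerivAt (adjD Φ) ((hx_adj n m).comp (fderiv ℝ (fderiv ℝ Φ) xb)) xb :=
    (hx_adj n m).hasFDerivAt.comp xb hd.hasFDerivAt
  have hg : gradxPsi f Φ xb vb ξ = fderiv ℝ f xb ξ +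
      ((hx_adj n m).comp (fderiv ℝ (fderiv ℝ Φ) xb)) ξ vb := by
    have := (hf'.add (hA.clm_apply (hasFDerivAt_const vb xb))).fderiv
    have e : gradxPsi f Φ xb vb = _ := this
    rw [e]; simp
  rw [hg]
  have t1 := hx_seq_lim hf' hx hc
  have t2 := (isBoundedBilinearMap_apply (𝕜 := ℝ) (E := Ev m) (F := Ev n)).continuous.tendsto _
    |>.comp ((hx_seq_lim hA hx hc).prodMk_nhds hv)
  refine (t1.add t2).congr fun k => ?_
  simp only [Psi, Function.comp_apply, ContinuousLinearMap.smul_apply, ContinuousLinearMap.sub_apply]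
  module

lemma hx_tcone {E : Type*} [NormedAddCommGroup E] [NormedSpace ℝ E] {s : Set E} {x h : E}
    (hx : x ∈ s) (hh : h ∈ tcone s x) :
    ∃ (z : ℕ → E) (c : ℕ → ℝ), (∀ k, z k ∈ s) ∧ Tendsto c atTop atTop ∧
      Tendsto z atTop (𝓝 x) ∧ Tendsto (fun k => c k • (z k - x)) atTop (𝓝 h) := by
  by_cases h0 : h = 0
  · subst h0
    exact ⟨fun _ => x, fun k => (k : ℝ), fun _ => hx, tendsto_natCast_atTop_atTop,
      tendsto_const_nhds, by simp⟩
  · obtain ⟨z, c, hz, hc, hzx, hlim⟩ := hh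
    refine ⟨z, c, hz, ?_, hzx, hlim⟩
    have hp : 0 < ‖h‖ := norm_pos_iff.2 h0
    have h1 : Tendsto (fun k => ‖z k - x‖) atTop (𝓝 0) := by
      simpa using (hzx.sub (tendsto_const_nhds (x := x))).norm
    rw [tendsto_atTop]
    intro B
    have hB : 0 < ‖h‖ / (2 * (|B| + 1)) := by positivity
    filter_upwards [hlim.norm.eventually (lt_mem_nhds (half_lt_self hp)),
      h1.eventually (gt_mem_nhds hB)] with k hk1 hk2
    rw [norm_smul, Real.norm_eq_abs, abs_of_nonneg (hc k)] at hk1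
    by_contra hcon
    push Not at hcon
    have hcB : c k ≤ |B| + 1 := by linarith [le_abs_self B]
    have : c k * ‖z k - x‖ ≤ (|B| + 1) * (‖h‖ / (2 * (|B| + 1))) :=
      mul_le_mul hcB hk2.le (norm_nonneg _) (by positivity)
    have e : (|B| + 1) * (‖h‖ / (2 * (|B| + 1))) = ‖h‖ / 2 := by
      field_simp
    linarith

lemma hx_zero_of_scaled {E : Type*} [NormedAddCommGroup E] [NormedSpace ℝ E] {p : ℕ → E} {q : E}
    {c : ℕ → ℝ} (hc : Tendsto c atTop atTop) (h : Tendsto (fun k => c k • p k) atTop (𝓝 q)) :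
    Tendsto p atTop (𝓝 0) := by
  have := (tendsto_inv_atTop_zero.comp hc).smul h
  rw [zero_smul] at this
  refine this.congr' ?_
  filter_upwards [hc.eventually (eventually_gt_atTop 0)] with k hk
  simp [smul_smul, inv_mul_cancel₀ hk.ne']

lemma hx_backward {n m : ℕ} (θ : CPWL m) (f : Ev n → Ev n) (Φ : Ev n → Ev m)
    (xb : Ev n) (vb : Ev m)
    (hf : ContDiffAt ℝ 1 f xb) (hPhi : ContDiffAt ℝ 2 Φ xb)
    (hvb : vb ∈ Lam f Φ θ xb) (hcrit : IsCritical f Φ θ xb vb)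
    (ε : ℝ) (hε : 0 < ε) (C : ℝ) (U : Set (Ev n)) (hU : U ∈ 𝓝 0)
    (W : Set (Ev m)) (hW : W ∈ 𝓝 0)
    (H : ∀ p₁ ∈ U, ∀ p₂ ∈ W, ∀ x : Ev n, ∀ v : Ev m,
          (x, v) ∈ Smap f Φ θ p₁ p₂ → ‖((x, v) : Ev n × Ev m) - (xb, vb)‖ ≤ ε →
            ‖x - xb‖ + Metric.infDist v (Lam f Φ θ xb) ≤ C * (‖p₁‖ + ‖p₂‖)) : False := by
  obtain ⟨ξ, hξ, w, hw, heq⟩ := hcrit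
  obtain ⟨y, c, hy, hc, hyx, hlim⟩ := hx_tcone (s := θ.gph) (x := (Φ xb, vb)) hvb.2 hw
  have hΦ' : HasFDerivAt Φ (fderiv ℝ Φ xb) xb := (hPhi.differentiableAt (by norm_num)).hasFDerivAt
  have hz : Tendsto (fun k => (y k).1) atTop (𝓝 (Φ xb)) := (continuous_fst.tendsto _).comp hyx
  have hv : Tendsto (fun k => (y k).2) atTop (𝓝 vb) := (continuous_snd.tendsto _).comp hyx
  have hcz : Tendsto (fun k => c k • ((y k).1 - Φ xb)) atTop (𝓝 (fderiv ℝ Φ xb ξ)) :=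
    (continuous_fst.tendsto _).comp hlim
  have hcv : Tendsto (fun k => c k • ((y k).2 - vb)) atTop (𝓝 w) :=
    (continuous_snd.tendsto _).comp hlim
  have hcpos := hc.eventually (eventually_gt_atTop 0)
  set x : ℕ → Ev n := fun k => xb + (c k)⁻¹ • ξ with hxdef
  have hcx : Tendsto (fun k => c k • (x k - xb)) atTop (𝓝 ξ) := by
    refine tendsto_const_nhds.congr' ?_
    filter_upwards [hcpos] with k hk
    simp [hxdef, smul_smul, mul_inv_cancel₀ hk.ne']
  have hx : Tendsto x atTop (𝓝 xb) := by
    have := (hx_zero_of_scaled hc hcx).add_const xb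
    simpa using this
  have hp1 : Tendsto (fun k => c k • Psi f Φ (x k) (y k).2) atTop (𝓝 0) := by
    have t1 := hx_psi_lim hf hPhi hx hv hcx
    have t2 := ((adjD Φ xb).continuous.tendsto _).comp hcv
    rw [← heq]
    refine (t1.add t2).congr fun k => ?_
    have h0 : Psi f Φ xb vb = 0 := hvb.1
    have e : Psi f Φ xb (y k).2 = adjD Φ xb ((y k).2 - vb) := by
      rw [← sub_zero (Psi f Φ xb (y k).2), ← h0, map_sub]
      simp only [Psi]; abel
    rw [e]
    simp only [Function.comp_apply, map_smul]
    module
  have hp2 : Tendsto (fun k => c k • ((y k).1 - Φ (x k))) atTop (𝓝 0) := by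
    have := hcz.sub (hx_seq_lim hΦ' hx hcx)
    rw [sub_self] at this
    refine this.congr fun k => ?_
    module
  have hq1 := hx_zero_of_scaled hc hp1
  have hq2 := hx_zero_of_scaled hc hp2
  have hxv : Tendsto (fun k => ‖((x k, (y k).2) : Ev n × Ev m) - (xb, vb)‖) atTop (𝓝 0) := by
    simpa using ((hx.prodMk_nhds hv).sub (tendsto_const_nhds (x := (xb, vb)))).norm
  have hev : ∀ᶠ k in atTop, ‖c k • (x k - xb)‖ ≤
      C * (‖c k • Psi f Φ (x k) (y k).2‖ + ‖c k • ((y k).1 - Φ (x k))‖) := by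
    filter_upwards [hcpos, hq1.eventually hU, hq2.eventually hW,
      hxv.eventually (gt_mem_nhds hε)] with k h1 h2 h3 h4
    have := H _ h2 _ h3 (x k) (y k).2 ⟨rfl, by
      have h6 : (y k).2 ∈ θ.subdiff (y k).1 := hy k
      simpa using h6⟩ h4.le
    have h5 : ‖x k - xb‖ ≤ C * (‖Psi f Φ (x k) (y k).2‖ + ‖(y k).1 - Φ (x k)‖) :=
      le_trans (le_add_of_nonneg_right Metric.infDist_nonneg) this
    simp only [norm_smul, Real.norm_eq_abs, abs_of_pos h1]
    have := mul_le_mul_of_nonneg_left h5 h1.le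
    linarith
  have := le_of_tendsto_of_tendsto hcx.norm ((hp1.norm.add hp2.norm).const_mul C) hev
  simp at this
  exact hξ this

lemma hx_forward {n m : ℕ} (θ : CPWL m) (f : Ev n → Ev n) (Φ : Ev n → Ev m)
    (xb : Ev n) (vb : Ev m)
    (hf : ContDiffAt ℝ 1 f xb) (hPhi : ContDiffAt ℝ 2 Φ xb)
    (hvb : vb ∈ Lam f Φ θ xb) (hcrit : ¬ IsCritical f Φ θ xb vb)
    (x p1 : ℕ → Ev n) (v p2 : ℕ → Ev m) (c : ℕ → ℝ) (ξ : Ev n)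
    (hx : Tendsto x atTop (𝓝 xb)) (hv : Tendsto v atTop (𝓝 vb)) (hc : Tendsto c atTop atTop)
    (hc0 : ∀ k, 0 < c k)
    (hcx : Tendsto (fun k => c k • (x k - xb)) atTop (𝓝 ξ))
    (hp1 : Tendsto (fun k => c k • p1 k) atTop (𝓝 0))
    (hp2 : Tendsto (fun k => c k • p2 k) atTop (𝓝 0))
    (hS : ∀ k, (x k, v k) ∈ Smap f Φ θ (p1 k) (p2 k))
    (h1 : ∀ k, c k * (‖x k - xb‖ + Metric.infDist (v k) (Lam f Φ θ xb)) = 1) : False := by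
  have hΦ' : HasFDerivAt Φ (fderiv ℝ Φ xb) xb := (hPhi.differentiableAt (by norm_num)).hasFDerivAt
  have hq2 := hx_zero_of_scaled hc hp2
  have h0 : Psi f Φ xb vb = 0 := hvb.1
  set z : ℕ → Ev m := fun k => Φ (x k) + p2 k with hzdef
  have hz : Tendsto z atTop (𝓝 (Φ xb)) := by
    simpa using (hΦ'.continuousAt.tendsto.comp hx).add hq2
  have hcz : Tendsto (fun k => c k • (z k - Φ xb)) atTop (𝓝 (fderiv ℝ Φ xb ξ)) := by
    have := (hx_seq_lim hΦ' hx hcx).add hp2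
    rw [add_zero] at this
    refine this.congr fun k => ?_
    simp only [hzdef]; module
  have hcA : Tendsto (fun k => c k • adjD Φ xb (v k - vb)) atTop (𝓝 (- gradxPsi f Φ xb vb ξ)) := by
    have := hp1.sub (hx_psi_lim hf hPhi hx hv hcx)
    rw [zero_sub] at this
    refine this.congr fun k => ?_
    have e : Psi f Φ xb (v k) = adjD Φ xb (v k - vb) := by
      rw [← sub_zero (Psi f Φ xb (v k)), ← h0, map_sub]
      simp only [Psi]; abel
    have e2 : Psi f Φ (x k) (v k) = p1 k := (hS k).1
    rw [e, e2]; module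
  obtain ⟨C, hC, φ, hφ, e, he⟩ := hx_struct θ (adjD Φ xb) z v (Φ xb) vb hz hv (fun k => (hS k).2)
  choose he1 he2 he3 he4 using he
  have hφt := hφ.tendsto_atTop
  have hcA' := hcA.comp hφt
  have hebd : ∀ k, ‖c (φ k) • e k‖ ≤ C * ‖c (φ k) • adjD Φ xb (v (φ k) - vb)‖ := by
    intro k
    have := mul_le_mul_of_nonneg_left (he2 k) (hc0 (φ k)).le
    simp only [norm_smul, Real.norm_eq_abs, abs_of_pos (hc0 (φ k))]
    linarith
  obtain ⟨R, hR⟩ := hcA'.norm.bddAbove_range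
  have hball : ∀ k, c (φ k) • e k ∈ Metric.closedBall (0 : Ev m) (C * R) := fun k => by
    rw [mem_closedBall_zero_iff]
    exact (hebd k).trans (mul_le_mul_of_nonneg_left (hR ⟨k, rfl⟩) hC)
  obtain ⟨w, _, ψ, hψ, hw⟩ := tendsto_subseq_of_bounded Metric.isBounded_closedBall hball
  have hψt := hψ.tendsto_atTop
  have hw : Tendsto (fun k => c (φ (ψ k)) • e (ψ k)) atTop (𝓝 w) := hw
  have hcc : Tendsto (fun k => c (φ (ψ k))) atTop atTop := (hc.comp hφt).comp hψt
  have hξ : ξ = 0 := by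
    by_contra hne
    apply hcrit
    refine ⟨ξ, hne, w, ?_, ?_⟩
    · refine ⟨fun k => (z (φ (ψ k)), vb + e (ψ k)), fun k => c (φ (ψ k)), fun k => he3 _,
        fun k => (hc0 _).le, ?_, ?_⟩
      · refine ((hz.comp hφt).comp hψt).prodMk_nhds ?_
        simpa using (hx_zero_of_scaled hcc hw).const_add vb
      · have := ((hcz.comp hφt).comp hψt).prodMk_nhds hw
        refine this.congr fun k => ?_
        simp
    · have t1 := ((adjD Φ xb).continuous.tendsto _).comp hw
      have t2 := hcA'.comp hψt
      have : adjD Φ xb w = - gradxPsi f Φ xb vb ξ := by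
        refine tendsto_nhds_unique t1 (t2.congr fun k => ?_)
        simp [he1]
      rw [this]; simp
  subst hξ
  have t1 : Tendsto (fun k => ‖c (φ k) • (x (φ k) - xb)‖ +
      C * ‖c (φ k) • adjD Φ xb (v (φ k) - vb)‖) atTop (𝓝 0) := by
    have := (hcx.comp hφt).norm.add (hcA'.norm.const_mul C)
    simpa using this
  have : (1:ℝ) ≤ 0 := by
    refine ge_of_tendsto' t1 fun k => ?_
    have hmem : v (φ k) - e k ∈ Lam f Φ θ xb := by
      refine ⟨?_, he4 k⟩
      have : Psi f Φ xb (v (φ k) - e k) = Psi f Φ xb vb := by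
        simp only [Psi, map_sub, he1]; abel
      rw [this, h0]
    have hd := Metric.infDist_le_dist_of_mem hmem (x := v (φ k))
    rw [dist_eq_norm, sub_sub_cancel] at hd
    rw [← h1 (φ k), mul_add]
    have := mul_le_mul_of_nonneg_left hd (hc0 (φ k)).le
    have h3 := hebd k
    rw [norm_smul (c (φ k)) (e k)] at h3
    rw [norm_smul (c (φ k)) (x (φ k) - xb)]
    rw [Real.norm_eq_abs, abs_of_pos (hc0 (φ k))] at h3 ⊢
    linarith
  linarith

/-- noncriticality is equivalent to semi-isolated calmness of the solution map
of the canonically perturbed variational system. -/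
theorem stmt6 {n m : ℕ} (θ : CPWL m) (f : Ev n → Ev n) (Φ : Ev n → Ev m)
    (xb : Ev n) (vb : Ev m)
    (hf : ContDiffAt ℝ 1 f xb) (hPhi : ContDiffAt ℝ 2 Φ xb)
    (hvb : vb ∈ Lam f Φ θ xb) :
    ¬ IsCritical f Φ θ xb vb ↔
      ∃ ε : ℝ, 0 < ε ∧ ∃ c : ℝ, 0 ≤ c ∧ ∃ U ∈ 𝓝 (0 : Ev n), ∃ W ∈ 𝓝 (0 : Ev m),
        ∀ p₁ ∈ U, ∀ p₂ ∈ W, ∀ x : Ev n, ∀ v : Ev m,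
          (x, v) ∈ Smap f Φ θ p₁ p₂ → ‖((x, v) : Ev n × Ev m) - (xb, vb)‖ ≤ ε →
            ‖x - xb‖ + Metric.infDist v (Lam f Φ θ xb) ≤ c * (‖p₁‖ + ‖p₂‖) := by
  constructor
  · intro hcrit
    by_contra hcon
    have hk : ∀ k : ℕ, ∃ (p₁ : Ev n) (p₂ : Ev m) (x : Ev n) (v : Ev m),
        (x, v) ∈ Smap f Φ θ p₁ p₂ ∧
        ‖((x, v) : Ev n × Ev m) - (xb, vb)‖ ≤ 1 / ((k:ℝ) + 1) ∧
        ((k:ℝ) + 1) * (‖p₁‖ + ‖p₂‖) < ‖x - xb‖ + Metric.infDist v (Lam f Φ θ xb) := by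
      intro k
      by_contra hno
      apply hcon
      refine ⟨1 / ((k:ℝ) + 1), by positivity, (k:ℝ) + 1, by positivity, univ, univ_mem, univ,
        univ_mem, fun p₁ _ p₂ _ x v h1 h2 => ?_⟩
      by_contra h3
      exact hno ⟨p₁, p₂, x, v, h1, h2, not_le.1 h3⟩
    choose p1 p2 x v hS hε hlt using hk
    set t : ℕ → ℝ := fun k => ‖x k - xb‖ + Metric.infDist (v k) (Lam f Φ θ xb) with ht
    have hpn : ∀ k : ℕ, 0 ≤ ((k:ℝ) + 1) * (‖p1 k‖ + ‖p2 k‖) := fun k => by positivity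
    have ht0 : ∀ k, 0 < t k := fun k => lt_of_le_of_lt (hpn k) (hlt k)
    have hx : Tendsto x atTop (𝓝 xb) := by
      rw [tendsto_iff_norm_sub_tendsto_zero]
      exact squeeze_zero (fun _ => norm_nonneg _)
        (fun k => (norm_fst_le (((x k, v k) : Ev n × Ev m) - (xb, vb))).trans (hε k))
        tendsto_one_div_add_atTop_nhds_zero_nat
    have hv' : Tendsto (fun k => ‖v k - vb‖) atTop (𝓝 0) :=
      squeeze_zero (fun _ => norm_nonneg _)
        (fun k => (norm_snd_le (((x k, v k) : Ev n × Ev m) - (xb, vb))).trans (hε k))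
        tendsto_one_div_add_atTop_nhds_zero_nat
    have hv : Tendsto v atTop (𝓝 vb) := tendsto_iff_norm_sub_tendsto_zero.2 hv'
    have htl : Tendsto t atTop (𝓝 0) := by
      have := (tendsto_iff_norm_sub_tendsto_zero.1 hx).add hv'
      rw [add_zero] at this
      refine squeeze_zero (fun k => (ht0 k).le) (fun k => ?_) this
      have := Metric.infDist_le_dist_of_mem hvb (x := v k)
      rw [dist_eq_norm] at this
      exact add_le_add le_rfl this
    have hc : Tendsto (fun k => (t k)⁻¹) atTop atTop :=
      tendsto_inv_nhdsGT_zero.comp (tendsto_nhdsWithin_iff.2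
        ⟨htl, Eventually.of_forall fun k => ht0 k⟩)
    have hpb : ∀ k : ℕ, (t k)⁻¹ * (‖p1 k‖ + ‖p2 k‖) ≤ 1 / ((k:ℝ) + 1) := by
      intro k
      rw [inv_mul_le_iff₀ (ht0 k), mul_one_div, le_div_iff₀ (by positivity)]
      linarith [hlt k]
    have hp1 : Tendsto (fun k => (t k)⁻¹ • p1 k) atTop (𝓝 0) := by
      rw [tendsto_zero_iff_norm_tendsto_zero]
      refine squeeze_zero (fun _ => norm_nonneg _) (fun k => le_trans ?_ (hpb k))
        tendsto_one_div_add_atTop_nhds_zero_nat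
      rw [norm_smul, Real.norm_eq_abs, abs_of_pos (inv_pos.2 (ht0 k))]
      exact mul_le_mul_of_nonneg_left (by linarith [norm_nonneg (p2 k)]) (inv_pos.2 (ht0 k)).le
    have hp2 : Tendsto (fun k => (t k)⁻¹ • p2 k) atTop (𝓝 0) := by
      rw [tendsto_zero_iff_norm_tendsto_zero]
      refine squeeze_zero (fun _ => norm_nonneg _) (fun k => le_trans ?_ (hpb k))
        tendsto_one_div_add_atTop_nhds_zero_nat
      rw [norm_smul, Real.norm_eq_abs, abs_of_pos (inv_pos.2 (ht0 k))]
      exact mul_le_mul_of_nonneg_left (by linarith [norm_nonneg (p1 k)]) (inv_pos.2 (ht0 k)).le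
    have hball : ∀ k, (t k)⁻¹ • (x k - xb) ∈ Metric.closedBall (0 : Ev n) 1 := by
      intro k
      rw [mem_closedBall_zero_iff, norm_smul, Real.norm_eq_abs, abs_of_pos (inv_pos.2 (ht0 k)),
        inv_mul_le_iff₀ (ht0 k), mul_one]
      exact le_add_of_nonneg_right Metric.infDist_nonneg
    obtain ⟨ξ, _, φ, hφ, hξ⟩ := tendsto_subseq_of_bounded Metric.isBounded_closedBall hball
    have hφt := hφ.tendsto_atTop
    exact hx_forward θ f Φ xb vb hf hPhi hvb hcrit (x ∘ φ) (p1 ∘ φ) (v ∘ φ) (p2 ∘ φ)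
      (fun k => (t (φ k))⁻¹) ξ (hx.comp hφt) (hv.comp hφt) (hc.comp hφt)
      (fun k => inv_pos.2 (ht0 _)) hξ (hp1.comp hφt) (hp2.comp hφt) (fun k => hS _)
      (fun k => inv_mul_cancel₀ (ht0 (φ k)).ne')
  · rintro ⟨ε, hε, C, _, U, hU, W, hW, H⟩ hcrit
    exact hx_backward θ f Φ xb vb hf hPhi hvb hcrit ε hε C U hU W hW H
end
end

section
/- Let θ be a CPWL function, let x̄, v̄, Ψ, Λ(x̄) be as in the variational-system setting with v̄ ∈ Λ(x̄), and assume in addition that f is continuously differentiable around x̄ and Φ is twice continuously differentiable around x̄. Then v̄ is a noncritical multiplier if and only if the following error bound holds: there are ε > 0 and ℓ ≥ 0 such that for every (x,v) with ‖(x,v) − (x̄,v̄)‖ ≤ ε one has ‖x − x̄‖ + dist(v, Λ(x̄)) ≤ ℓ(‖Ψ(x,v)‖ + dist(Φ(x), (∂θ)⁻¹(v))), where (∂θ)⁻¹(v) := {z : v ∈ ∂θ(z)} and the distance to the empty set is interpreted as +∞. -/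
open Filter Topology Set RealInnerProductSpace

noncomputable section

/-- positively independent bound -/
lemma kl_aux {J E : Type*} [Fintype J] [NormedAddCommGroup E] [NormedSpace ℝ E]
    (M : (J → ℝ) →ₗ[ℝ] E) (S : Set J)
    (hS : ∀ κ : J → ℝ, 0 ≤ κ → (∀ j, j ∉ S → κ j = 0) → M κ = 0 → κ = 0) :
    ∃ C : ℝ, 0 ≤ C ∧ ∀ x : J → ℝ, 0 ≤ x → (∀ j, j ∉ S → x j = 0) → ‖x‖ ≤ C * ‖M x‖ := by
  have hMc : Continuous M := M.continuous_of_finiteDimensional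
  set K : Set (J → ℝ) := {x | 0 ≤ x ∧ (∀ j, j ∉ S → x j = 0) ∧ ‖x‖ = 1} with hK
  have hKc : IsCompact K := by
    apply (isCompact_closedBall (0 : J → ℝ) 1).of_isClosed_subset
    · have h1 : IsClosed {x : J → ℝ | 0 ≤ x} := isClosed_le continuous_const continuous_id
      have h2 : IsClosed {x : J → ℝ | ∀ j, j ∉ S → x j = 0} := by
        simp only [ofPred_forall]
        exact isClosed_iInter fun j => isClosed_iInter fun _ =>
          isClosed_eq (continuous_apply j) continuous_const
      have h3 : IsClosed {x : J → ℝ | ‖x‖ = 1} := isClosed_eq continuous_norm continuous_const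
      exact h1.inter (h2.inter h3)
    · intro x hx
      simp [hx.2.2]
  rcases K.eq_empty_or_nonempty with he | hne
  · refine ⟨0, le_rfl, fun x hx hs => ?_⟩
    by_cases h0 : x = 0
    · simp [h0]
    exfalso
    have : (‖x‖⁻¹ • x) ∈ K := by
      refine ⟨smul_nonneg (by positivity) hx, fun j hj => by simp [hs j hj], ?_⟩
      rw [norm_smul, norm_inv, norm_norm, inv_mul_cancel₀ (norm_ne_zero_iff.2 h0)]
    rw [he] at this
    exact this
  · obtain ⟨y, hy, hmin⟩ := hKc.exists_isMinOn hne (f := fun x => ‖M x‖) (by fun_prop)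
    have hpos : 0 < ‖M y‖ := by
      rw [norm_pos_iff]
      intro h
      have := hS y hy.1 hy.2.1 h
      have h1 := hy.2.2
      rw [this] at h1
      simp at h1
    refine ⟨‖M y‖⁻¹, by positivity, fun x hx hs => ?_⟩
    by_cases h0 : x = 0
    · simp [h0]
    have hn : 0 < ‖x‖ := norm_pos_iff.2 h0
    have : (‖x‖⁻¹ • x) ∈ K := by
      refine ⟨smul_nonneg (by positivity) hx, fun j hj => by simp [hs j hj], ?_⟩
      rw [norm_smul, norm_inv, norm_norm, inv_mul_cancel₀ (norm_ne_zero_iff.2 h0)]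
    have h2 : ‖M y‖ ≤ ‖M (‖x‖⁻¹ • x)‖ := hmin this
    rw [map_smul, norm_smul, norm_inv, norm_norm] at h2
    rw [inv_mul_eq_div, le_div_iff₀ hpos]
    rw [inv_mul_eq_div, le_div_iff₀ hn] at h2
    linarith

lemma kl {J E : Type*} [Fintype J] [NormedAddCommGroup E] [NormedSpace ℝ E]
    (M : (J → ℝ) →ₗ[ℝ] E) :
    ∃ C : ℝ, 0 ≤ C ∧ ∀ x : J → ℝ, 0 ≤ x → ∃ y : J → ℝ, 0 ≤ y ∧ y ≤ x ∧ M y = M x ∧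
      ‖y‖ ≤ C * ‖M x‖ := by
  classical
  have hMc : Continuous M := M.continuous_of_finiteDimensional
  have key : ∀ S : Set J, ∃ C : ℝ, 0 ≤ C ∧
      ((∀ κ : J → ℝ, 0 ≤ κ → (∀ j, j ∉ S → κ j = 0) → M κ = 0 → κ = 0) →
      ∀ x : J → ℝ, 0 ≤ x → (∀ j, j ∉ S → x j = 0) → ‖x‖ ≤ C * ‖M x‖) := by
    intro S
    by_cases hS : (∀ κ : J → ℝ, 0 ≤ κ → (∀ j, j ∉ S → κ j = 0) → M κ = 0 → κ = 0)
    · obtain ⟨C, h0, h⟩ := kl_aux M S hS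
      exact ⟨C, h0, fun _ => h⟩
    · exact ⟨0, le_rfl, fun h => absurd h hS⟩
  choose C hC0 hC using key
  refine ⟨∑ S, C S, Finset.sum_nonneg fun S _ => hC0 S, fun x hx => ?_⟩
  set K : Set (J → ℝ) := Icc 0 x ∩ {y | M y = M x}
  have hKc : IsCompact K := isCompact_Icc.inter_right (isClosed_eq hMc continuous_const)
  obtain ⟨y, hy, hmin⟩ := hKc.exists_isMinOn ⟨x, ⟨hx, le_rfl⟩, rfl⟩
    (f := fun y => ∑ j, y j) (by fun_prop)
  refine ⟨y, hy.1.1, hy.1.2, hy.2, ?_⟩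
  have hyM : M y = M x := hy.2
  have hb := hC {j | y j ≠ 0} ?_ y hy.1.1 (fun j hj => by simpa using hj)
  · rw [hyM] at hb
    refine hb.trans ?_
    gcongr
    exact Finset.single_le_sum (f := C) (fun S _ => hC0 S) (Finset.mem_univ _)
  · intro κ hκ hs hMκ
    by_contra hne
    have : ∀ j, ∀ᶠ t in 𝓝[>] (0 : ℝ), t * κ j ≤ y j := by
      intro j
      by_cases hj : y j = 0
      · have := hs j (by simpa using hj)
        simp [this, hj]
      · have hyj : 0 < y j := lt_of_le_of_ne (hy.1.1 j) (Ne.symm hj)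
        have ht : Tendsto (fun t : ℝ => t * κ j) (𝓝[>] 0) (𝓝 (0 * κ j)) :=
          ((continuous_id.mul continuous_const).tendsto 0).mono_left nhdsWithin_le_nhds
        rw [zero_mul] at ht
        exact (ht.eventually (gt_mem_nhds hyj)).mono fun t h => h.le
    obtain ⟨t, ht, ht0⟩ := ((eventually_all.2 this).and self_mem_nhdsWithin).exists
    have ht0 : 0 < t := ht0
    have hmem : y - t • κ ∈ K := by
      refine ⟨⟨fun j => ?_, fun j => ?_⟩, ?_⟩
      · simpa using ht j
      · have h1 := hy.1.2 j
        have h2 := mul_nonneg ht0.le (hκ j)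
        simp only [Pi.sub_apply, Pi.smul_apply, smul_eq_mul]
        linarith
      · simp [hMκ, hyM]
    have h3 : ∑ j, y j ≤ ∑ j, (y - t • κ) j := hmin hmem
    simp only [Pi.sub_apply, Pi.smul_apply, smul_eq_mul, Finset.sum_sub_distrib,
      ← Finset.mul_sum] at h3
    have h4 : 0 ≤ ∑ j, κ j := Finset.sum_nonneg fun j _ => hκ j
    have h5 : ∑ j, κ j = 0 := by nlinarith
    rw [Finset.sum_eq_zero_iff_of_nonneg (fun j _ => hκ j)] at h5
    exact hne (funext fun j => h5 j (Finset.mem_univ j))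

lemma cone_closed {J E : Type*} [Fintype J] [NormedAddCommGroup E] [NormedSpace ℝ E]
    (M : (J → ℝ) →ₗ[ℝ] E) (S : Set J) :
    IsClosed (M '' {x | 0 ≤ x ∧ ∀ j, j ∉ S → x j = 0}) := by
  have hMc : Continuous M := M.continuous_of_finiteDimensional
  obtain ⟨C, hC0, hC⟩ := kl M
  have h1 : IsClosed {x : J → ℝ | 0 ≤ x} := isClosed_le continuous_const continuous_id
  have h2 : IsClosed {x : J → ℝ | ∀ j, j ∉ S → x j = 0} := by
    simp only [ofPred_forall]
    exact isClosed_iInter fun j => isClosed_iInter fun _ =>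
      isClosed_eq (continuous_apply j) continuous_const
  have hcl : IsClosed {x : J → ℝ | 0 ≤ x ∧ ∀ j, j ∉ S → x j = 0} := h1.inter h2
  refine isClosed_of_closure_subset fun c hc => ?_
  have hK : IsCompact (M '' (Metric.closedBall 0 (C * (‖c‖ + 1)) ∩
      {x : J → ℝ | 0 ≤ x ∧ ∀ j, j ∉ S → x j = 0})) :=
    ((isCompact_closedBall _ _).inter_right hcl).image hMc
  have : c ∈ M '' (Metric.closedBall 0 (C * (‖c‖ + 1)) ∩
      {x : J → ℝ | 0 ≤ x ∧ ∀ j, j ∉ S → x j = 0}) := by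
    rw [← hK.isClosed.closure_eq]
    rw [Metric.mem_closure_iff] at hc ⊢
    intro ε hε
    obtain ⟨b, ⟨x, ⟨hx0, hxs⟩, rfl⟩, hb⟩ := hc (min ε 1) (by positivity)
    obtain ⟨y, hy0, hyx, hMy, hyn⟩ := hC x hx0
    refine ⟨M x, ⟨y, ⟨?_, hy0, fun j hj => ?_⟩, hMy⟩, hb.trans_le (min_le_left _ _)⟩
    · rw [mem_closedBall_zero_iff]
      refine hyn.trans ?_
      gcongr
      have h3 := hb.trans_le (min_le_right _ _)
      rw [dist_eq_norm'] at h3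
      have := norm_le_norm_add_norm_sub' (M x) c
      linarith
    · exact le_antisymm ((hyx j).trans_eq (hxs j hj)) (hy0 j)
  exact image_mono inter_subset_right this

/-- polyhedral Lipschitz selection -/
lemma polysel {J E F : Type*} [Fintype J] [NormedAddCommGroup E] [NormedSpace ℝ E]
    [NormedAddCommGroup F] [NormedSpace ℝ F]
    (M : (J → ℝ) →ₗ[ℝ] E) (B : E →ₗ[ℝ] F) :
    ∃ C : ℝ, 0 ≤ C ∧ ∀ x y : J → ℝ, 0 ≤ x → 0 ≤ y → ∃ u : J → ℝ, 0 ≤ u ∧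
      (∀ j, x j = 0 → y j = 0 → u j = 0) ∧ B (M u) = B (M x) ∧
      ‖M u - M y‖ ≤ C * ‖B (M x - M y)‖ := by
  set D : ((J ⊕ J) → ℝ) →ₗ[ℝ] (J → ℝ) :=
    LinearMap.funLeft ℝ ℝ Sum.inl - LinearMap.funLeft ℝ ℝ Sum.inr with hD
  obtain ⟨C, hC0, hC⟩ := kl (B ∘ₗ M ∘ₗ D)
  set M' : (((J ⊕ J) → ℝ)) →L[ℝ] E := LinearMap.toContinuousLinearMap (M ∘ₗ D)
  have hM' : ∀ q, M' q = M (D q) := fun q => rfl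
  refine ⟨‖M'‖ * C, by positivity, fun x y hx hy => ?_⟩
  have hDxy : D (Sum.elim (x ⊔ y - y) (x ⊔ y - x)) = x - y := by
    ext j
    simp [hD, LinearMap.funLeft_apply]
  obtain ⟨q, hq0, hqle, hqM, hqn⟩ := hC (Sum.elim (x ⊔ y - y) (x ⊔ y - x)) (by
    rintro (j | j) <;> simp)
  simp only [LinearMap.comp_apply, hDxy] at hqM hqn
  have hDj : ∀ j, D q j = q (Sum.inl j) - q (Sum.inr j) := fun j => by
    simp [hD, LinearMap.funLeft_apply]
  refine ⟨y + D q, fun j => ?_, fun j h1 h2 => ?_, ?_, ?_⟩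
  · have h1 := hq0 (Sum.inl j)
    have h2 := hqle (Sum.inr j)
    have h3 := hx j
    have h4 := hy j
    simp only [Sum.elim_inr, Pi.sub_apply, Pi.sup_apply, Pi.zero_apply] at h1 h2 h3 h4
    have h5 : max (x j) (y j) ≤ x j + y j := max_le (by linarith) (by linarith)
    change 0 ≤ y j + D q j
    rw [hDj]
    linarith
  · have h3 := hqle (Sum.inl j)
    have h4 := hqle (Sum.inr j)
    have h5 := hq0 (Sum.inl j)
    have h6 := hq0 (Sum.inr j)
    simp [h1, h2] at h3 h4 h5 h6
    change y j + D q j = 0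
    rw [hDj]
    linarith
  · rw [map_add, map_add, hqM, map_sub, map_sub]; abel
  · rw [map_add, add_sub_cancel_left, ← hM']
    refine (M'.le_opNorm q).trans ?_
    rw [mul_assoc]
    rw [map_sub] at hqn
    gcongr

namespace CPWL

variable {m : ℕ} (θ : CPWL m)

/-- Generators. -/
def gen : Fin θ.l ⊕ Fin θ.p → Ev m × ℝ := Sum.elim (fun i => (θ.a i, 1)) (fun j => (θ.d j, 0))

/-- Generator map. -/
def MM : (Fin θ.l ⊕ Fin θ.p → ℝ) →ₗ[ℝ] Ev m × ℝ := Fintype.linearCombination ℝ θ.gen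

/-- Joint active set. -/
def Act (z : Ev m) : Set (Fin θ.l ⊕ Fin θ.p) :=
  {j | Sum.elim (fun i => θ.val z = ⟪θ.a i, z⟫ - θ.al i) (fun i => ⟪θ.d i, z⟫ = θ.be i) j}

lemma le_val (z : Ev m) (i : Fin θ.l) : ⟪θ.a i, z⟫ - θ.al i ≤ θ.val z :=
  le_ciSup (f := fun i => ⟪θ.a i, z⟫ - θ.al i) (Set.finite_range _).bddAbove i

lemma val_le {z : Ev m} {r : ℝ} (h : ∀ i, ⟪θ.a i, z⟫ - θ.al i ≤ r) : θ.val z ≤ r := by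
  have : Nonempty (Fin θ.l) := ⟨⟨0, θ.hl⟩⟩
  exact ciSup_le h

lemma MM_apply (x : Fin θ.l ⊕ Fin θ.p → ℝ) : θ.MM x =
    (∑ i, x (Sum.inl i) • θ.a i + ∑ j, x (Sum.inr j) • θ.d j, ∑ i, x (Sum.inl i)) := by
  simp [MM, Fintype.linearCombination_apply, gen, Prod.ext_iff, Prod.fst_sum, Prod.snd_sum]

lemma val_continuous : Continuous θ.val := by
  have : Nonempty (Fin θ.l) := ⟨⟨0, θ.hl⟩⟩
  have : θ.val = fun z => Finset.univ.sup' Finset.univ_nonempty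
      (fun i : Fin θ.l => ⟪θ.a i, z⟫ - θ.al i) := by
    ext z
    rw [Finset.sup'_univ_eq_ciSup]
    rfl
  rw [this]
  exact Continuous.finset_sup'_apply _ fun i _ => by fun_prop

/-- V-representation of the subdifferential. -/
lemma mem_subdiff_iff (z v : Ev m) : v ∈ θ.subdiff z ↔ z ∈ θ.dom ∧
    ∃ x : Fin θ.l ⊕ Fin θ.p → ℝ, 0 ≤ x ∧ (∀ j, j ∉ θ.Act z → x j = 0) ∧ θ.MM x = (v, 1) := by
  constructor
  · rintro ⟨hz, hv⟩
    refine ⟨hz, ?_⟩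
    by_contra hcon
    set Cn := θ.MM '' {x | 0 ≤ x ∧ ∀ j, j ∉ θ.Act z → x j = 0} with hCn
    have hcl : IsClosed Cn := cone_closed _ _
    have hconv : Convex ℝ Cn := by
      apply Convex.linear_image
      rintro x ⟨hx, hxs⟩ y ⟨hy, hys⟩ a b ha hb _
      refine ⟨add_nonneg (smul_nonneg ha hx) (smul_nonneg hb hy), fun j hj => ?_⟩
      simp [hxs j hj, hys j hj]
    have hnot : (v, (1 : ℝ)) ∉ Cn := by
      rintro ⟨x, ⟨h1, h2⟩, h3⟩
      exact hcon ⟨x, h1, h2, h3⟩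
    obtain ⟨φ, u, hφ, hu⟩ := geometric_hahn_banach_closed_point hconv hcl hnot
    have hsm : ∀ j ∈ θ.Act z, φ (θ.gen j) ≤ 0 := by
      intro j hj
      by_contra! hpos
      have hu0 : 0 < u := by
        simpa using hφ 0 ⟨0, ⟨le_rfl, fun _ _ => rfl⟩, map_zero _⟩
      have := hφ ((u / φ (θ.gen j)) • θ.gen j) (by
        classical
        refine ⟨Pi.single j (u / φ (θ.gen j)), ⟨?_, ?_⟩, ?_⟩
        · rw [Pi.single_nonneg]; positivity
        · intro i hi
          apply Pi.single_eq_of_ne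
          rintro rfl
          exact hi hj
        · simp [MM, Fintype.linearCombination_apply_single])
      rw [map_smul, smul_eq_mul, div_mul_cancel₀ _ hpos.ne'] at this
      exact lt_irrefl _ this
    have hu0 : 0 < φ (v, 1) := by
      have h0 : 0 < u := by
        simpa using hφ 0 ⟨0, ⟨le_rfl, fun _ _ => rfl⟩, map_zero _⟩
      linarith
    set ψ : Ev m →L[ℝ] ℝ := φ.comp (ContinuousLinearMap.inl ℝ (Ev m) ℝ)
    set y : Ev m := (InnerProductSpace.toDual ℝ (Ev m)).symm ψ with hy
    set τ : ℝ := φ (0, 1) with hτ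
    have hrep : ∀ w : Ev m, ∀ r : ℝ, φ (w, r) = ⟪w, y⟫ + r * τ := by
      intro w r
      have h1 : ⟪w, y⟫ = φ (w, 0) := by
        rw [real_inner_comm, hy, InnerProductSpace.toDual_symm_apply]
        rfl
      have h2 : (w, r) = (w, (0 : ℝ)) + r • ((0 : Ev m), (1 : ℝ)) := by simp
      rw [h2, map_add, map_smul, h1, smul_eq_mul]
    have htz : Tendsto (fun t : ℝ => z + t • y) (𝓝[>] 0) (𝓝 z) := by
      have : Tendsto (fun t : ℝ => z + t • y) (𝓝 0) (𝓝 (z + (0 : ℝ) • y)) :=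
        Continuous.tendsto (by fun_prop) 0
      simpa using this.mono_left nhdsWithin_le_nhds
    have hpos : ∀ᶠ t in 𝓝[>] (0 : ℝ), 0 < t := self_mem_nhdsWithin
    have hdom : ∀ i, ∀ᶠ t in 𝓝[>] (0 : ℝ), ⟪θ.d i, z + t • y⟫ ≤ θ.be i := by
      intro i
      by_cases hi : ⟪θ.d i, z⟫ = θ.be i
      · have h1 := hsm (Sum.inr i) hi
        simp only [gen, Sum.elim_inr, hrep] at h1
        filter_upwards [hpos] with t ht
        rw [inner_add_right, inner_smul_right]
        nlinarith
      · have h1 : ⟪θ.d i, z⟫ < θ.be i := lt_of_le_of_ne (hz i) hi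
        have h2 : Tendsto (fun t : ℝ => ⟪θ.d i, z + t • y⟫) (𝓝[>] 0) (𝓝 ⟪θ.d i, z⟫) :=
          tendsto_const_nhds.inner htz
        exact (h2.eventually (gt_mem_nhds h1)).mono fun t h => h.le
    have hval : ∀ i, ∀ᶠ t in 𝓝[>] (0 : ℝ), ⟪θ.a i, z + t • y⟫ - θ.al i ≤ θ.val z - t * τ := by
      intro i
      by_cases hi : θ.val z = ⟪θ.a i, z⟫ - θ.al i
      · have h1 := hsm (Sum.inl i) hi
        simp only [gen, Sum.elim_inl, hrep] at h1
        filter_upwards [hpos] with t ht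
        rw [inner_add_right, inner_smul_right]
        nlinarith
      · have h1 : ⟪θ.a i, z⟫ - θ.al i < θ.val z := lt_of_le_of_ne (θ.le_val z i) (Ne.symm hi)
        have h2 : Tendsto (fun t : ℝ => ⟪θ.a i, z + t • y⟫ - θ.al i + t * τ) (𝓝[>] 0)
            (𝓝 (⟪θ.a i, z⟫ - θ.al i + 0 * τ)) := by
          refine ((tendsto_const_nhds.inner htz).sub tendsto_const_nhds).add ?_
          exact (Continuous.tendsto (by fun_prop : Continuous fun t : ℝ => t * τ) 0).mono_left
            nhdsWithin_le_nhds
        rw [zero_mul, add_zero] at h2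
        exact (h2.eventually (gt_mem_nhds h1)).mono fun t h => by linarith
    obtain ⟨t, ⟨ht1, ht2⟩, ht0⟩ :=
      (((eventually_all.2 hdom).and (eventually_all.2 hval)).and hpos).exists
    have h1 := hv (z + t • y) ht1
    have h2 := θ.val_le ht2
    rw [add_sub_cancel_left, inner_smul_right] at h1
    rw [hrep] at hu0
    nlinarith
  · rintro ⟨hz, x, hx, hxs, hM⟩
    refine ⟨hz, fun z' hz' => ?_⟩
    rw [MM_apply, Prod.ext_iff] at hM
    obtain ⟨h1, h2⟩ := hM
    simp only at h1 h2
    rw [← h1, inner_add_left, sum_inner, sum_inner]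
    have e1 : ∑ i, ⟪x (Sum.inl i) • θ.a i, z' - z⟫ ≤
        ∑ i, x (Sum.inl i) * (θ.val z' - θ.val z) := by
      refine Finset.sum_le_sum fun i _ => ?_
      rw [real_inner_smul_left]
      by_cases hi : Sum.inl i ∈ θ.Act z
      · have hi' : θ.val z = ⟪θ.a i, z⟫ - θ.al i := hi
        refine mul_le_mul_of_nonneg_left ?_ (hx _)
        rw [inner_sub_right]
        have := θ.le_val z' i
        linarith
      · simp [hxs _ hi]
    have e2 : ∑ i, ⟪x (Sum.inr i) • θ.d i, z' - z⟫ ≤ 0 := by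
      refine Finset.sum_nonpos fun i _ => ?_
      rw [real_inner_smul_left]
      by_cases hi : Sum.inr i ∈ θ.Act z
      · have hi' : ⟪θ.d i, z⟫ = θ.be i := hi
        refine mul_nonpos_of_nonneg_of_nonpos (hx _) ?_
        rw [inner_sub_right]
        have := hz' i
        linarith
      · simp [hxs _ hi]
    rw [← Finset.sum_mul, h2, one_mul] at e1
    linarith

lemma subdiff_closed (z : Ev m) : IsClosed (θ.subdiff z) := by
  by_cases hz : z ∈ θ.dom
  · have : θ.subdiff z = ⋂ z' ∈ θ.dom, {v | ⟪v, z' - z⟫ ≤ θ.val z' - θ.val z} := by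
      ext v
      simp [subdiff, hz]
    rw [this]
    exact isClosed_biInter fun z' _ => isClosed_le (by fun_prop) continuous_const
  · have : θ.subdiff z = ∅ := by
      ext v
      simp [subdiff, hz]
    rw [this]
    exact isClosed_empty

lemma sel {n : ℕ} (A : Ev m →L[ℝ] Ev n) : ∃ C : ℝ, 0 ≤ C ∧ ∀ z, ∀ v ∈ θ.subdiff z,
    ∀ w ∈ θ.subdiff z, ∃ u ∈ θ.subdiff z, A u = A v ∧ ‖u - w‖ ≤ C * ‖A (v - w)‖ := by
  obtain ⟨C, hC0, hC⟩ := polysel θ.MM (LinearMap.prodMap (A : Ev m →ₗ[ℝ] Ev n) LinearMap.id)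
  refine ⟨C, hC0, fun z v hv w hw => ?_⟩
  rw [mem_subdiff_iff] at hv hw
  obtain ⟨hz, x, hx, hxs, hxM⟩ := hv
  obtain ⟨-, y, hy, hys, hyM⟩ := hw
  obtain ⟨u, hu, hus, hBu, hun⟩ := hC x y hx hy
  rw [hxM, Prod.ext_iff] at hBu
  rw [hxM, hyM] at hun
  simp only [LinearMap.prodMap_apply, LinearMap.id_apply, ContinuousLinearMap.coe_coe] at hBu
  refine ⟨(θ.MM u).1, (θ.mem_subdiff_iff z _).2 ⟨hz, u, hu,
    fun j hj => hus j (hxs j hj) (hys j hj), Prod.ext rfl hBu.2⟩, hBu.1, ?_⟩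
  refine (le_trans ?_ hun).trans_eq ?_
  · exact norm_fst_le (θ.MM u - (w, 1))
  · simp [LinearMap.prodMap_apply, Prod.norm_def]

lemma subdiff_osc (zb : Ev m) : ∀ᶠ z in 𝓝 zb, θ.subdiff z ⊆ θ.subdiff zb ∨ zb ∉ θ.dom := by
  by_cases hzb : zb ∈ θ.dom
  swap
  · exact Eventually.of_forall fun _ => Or.inr hzb
  have h : ∀ j, ∀ᶠ z in 𝓝 zb, j ∉ θ.Act zb → j ∉ θ.Act z := by
    rintro (i | i)
    · by_cases hi : θ.val zb = ⟪θ.a i, zb⟫ - θ.al i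
      · exact Eventually.of_forall fun _ h => absurd hi h
      · have : IsOpen {z | θ.val z ≠ ⟪θ.a i, z⟫ - θ.al i} :=
          isOpen_ne_fun θ.val_continuous (by fun_prop)
        filter_upwards [this.mem_nhds hi] with z hz _
        exact hz
    · by_cases hi : ⟪θ.d i, zb⟫ = θ.be i
      · exact Eventually.of_forall fun _ h => absurd hi h
      · have : IsOpen {z | ⟪θ.d i, z⟫ ≠ θ.be i} :=
          isOpen_ne_fun (by fun_prop) (by fun_prop)
        filter_upwards [this.mem_nhds hi] with z hz _
        exact hz
  filter_upwards [eventually_all.2 h] with z hz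
  left
  intro v hv
  rw [mem_subdiff_iff] at hv ⊢
  obtain ⟨_, x, hx, hxs, hM⟩ := hv
  exact ⟨hzb, x, hx, fun j hj => hxs j (hz j hj), hM⟩

lemma subdiff_stable (vb : Ev m) : ∀ᶠ v in 𝓝 vb, ∀ z, v ∈ θ.subdiff z → vb ∈ θ.subdiff z := by
  have h : ∀ S : Set (Fin θ.l ⊕ Fin θ.p), ∀ᶠ v in 𝓝 vb,
      ∀ z, θ.Act z = S → v ∈ θ.subdiff z → vb ∈ θ.subdiff z := by
    intro S
    by_cases hS : ∃ z, z ∈ θ.dom ∧ θ.Act z = S ∧ vb ∉ θ.subdiff z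
    · obtain ⟨z₀, hz₀, hA, hn⟩ := hS
      filter_upwards [(θ.subdiff_closed z₀).isOpen_compl.mem_nhds hn] with v hv z hz hvz
      exfalso
      apply hv
      rw [mem_subdiff_iff] at hvz ⊢
      rw [hA, ← hz]
      exact ⟨hz₀, hvz.2⟩
    · refine Eventually.of_forall fun v z hz hv => ?_
      by_contra hn
      exact hS ⟨z, hv.1, hz, hn⟩
  filter_upwards [eventually_all.2 h] with v hv z
  exact hv _ z rfl

end CPWL

lemma enn_aux {E : Type*} [NormedAddCommGroup E] (s : Set E) (x : E) (c p r : ℝ) (hc : 0 < c)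
    (hp : 0 ≤ p)
    (h : ENNReal.ofReal c * (ENNReal.ofReal p + EMetric.infEdist x s) < ENNReal.ofReal r) :
    ∃ z ∈ s, c * (p + ‖x - z‖) < r := by
  by_contra! hcon
  refine absurd h (not_lt.2 ?_)
  have h1 : ENNReal.ofReal (r / c - p) ≤ EMetric.infEdist x s := by
    refine Metric.le_infEDist.2 fun z hz => ?_
    rw [edist_dist]
    apply ENNReal.ofReal_le_ofReal
    rw [dist_eq_norm, sub_le_iff_le_add', div_le_iff₀' hc]
    exact hcon z hz
  calc ENNReal.ofReal r = ENNReal.ofReal (c * (p + (r / c - p))) := by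
        congr 1; field_simp; ring
    _ = ENNReal.ofReal c * ENNReal.ofReal (p + (r / c - p)) := ENNReal.ofReal_mul hc.le
    _ ≤ ENNReal.ofReal c * (ENNReal.ofReal p + ENNReal.ofReal (r / c - p)) := by
        gcongr; exact ENNReal.ofReal_add_le
    _ ≤ _ := by gcongr

lemma tcone_seq {E : Type*} [NormedAddCommGroup E] [NormedSpace ℝ E] {s : Set E} {x w : E}
    (hx : x ∈ s) (hw : w ∈ tcone s x) (η : ℝ) (hη : 0 < η) :
    ∃ t : ℝ, 0 < t ∧ t < η ∧ ∃ z ∈ s, ‖t⁻¹ • (z - x) - w‖ < η := by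
  by_cases h0 : w = 0
  · exact ⟨η / 2, by positivity, by linarith, x, hx, by simpa [h0] using hη⟩
  obtain ⟨z, c, hz, hc, hzx, hlim⟩ := hw
  have hwp : 0 < ‖w‖ := norm_pos_iff.2 h0
  have e1 : ∀ᶠ k in atTop, ‖w‖ / 2 < ‖c k • (z k - x)‖ :=
    hlim.norm.eventually (lt_mem_nhds (by linarith))
  have e2 : ∀ᶠ k in atTop, ‖c k • (z k - x) - w‖ < η := by
    have := (hlim.sub_const w).norm
    rw [sub_self, norm_zero] at this
    exact this.eventually (gt_mem_nhds hη)
  have e3 : ∀ᶠ k in atTop, ‖z k - x‖ < η * (‖w‖ / 2) := by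
    have := (hzx.sub_const x).norm
    rw [sub_self, norm_zero] at this
    exact this.eventually (gt_mem_nhds (by positivity))
  obtain ⟨k, ⟨h1, h2⟩, h3⟩ := ((e1.and e2).and e3).exists
  rw [norm_smul, Real.norm_of_nonneg (hc k)] at h1
  have hck : 0 < c k := by
    rcases (hc k).eq_or_lt with h | h
    · rw [← h] at h1; linarith
    · exact h
  refine ⟨(c k)⁻¹, by positivity, ?_, z k, hz k, by simpa using h2⟩
  rw [inv_lt_comm₀ hck hη]
  by_contra! hle
  have : c k * ‖z k - x‖ ≤ η⁻¹ * ‖z k - x‖ := by gcongr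
  have h4 : η⁻¹ * ‖z k - x‖ ≤ η⁻¹ * (η * (‖w‖ / 2)) := by gcongr
  rw [inv_mul_cancel_left₀ hη.ne'] at h4
  linarith

lemma fd_lim {E F : Type*} [NormedAddCommGroup E] [NormedSpace ℝ E] [NormedAddCommGroup F]
    [NormedSpace ℝ F] {G : E → F} {G' : E →L[ℝ] F} {xb ξ : E} (hG : HasFDerivAt G G' xb)
    {x : ℕ → E} {c : ℕ → ℝ} (hx : Tendsto x atTop (𝓝 xb))
    (hc : Tendsto (fun k => c k • (x k - xb)) atTop (𝓝 ξ)) :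
    Tendsto (fun k => c k • (G (x k) - G xb)) atTop (𝓝 (G' ξ)) := by
  have := (hasFDerivWithinAt_univ.2 hG).lim (l := atTop) (c := c) (d := fun k => x k - xb) (v := ξ)
    (by simpa using hx.sub_const xb) (Eventually.of_forall fun _ => mem_univ _) hc
  simpa using this

lemma clm_lim {E F : Type*} [NormedAddCommGroup E] [NormedSpace ℝ E] [NormedAddCommGroup F]
    [NormedSpace ℝ F] {T : ℕ → E →L[ℝ] F} {T₀ : E →L[ℝ] F} {y : ℕ → E} {y₀ : E}
    (hT : Tendsto T atTop (𝓝 T₀)) (hy : Tendsto y atTop (𝓝 y₀)) :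
    Tendsto (fun k => T k (y k)) atTop (𝓝 (T₀ y₀)) :=
  ((isBoundedBilinearMap_apply (𝕜 := ℝ) (E := E) (F := F)).continuous.tendsto (T₀, y₀)).comp
    (hT.prodMk_nhds hy)

section Main

variable {n m : ℕ} {θ : CPWL m} {f : Ev n → Ev n} {Φ : Ev n → Ev m} {xb : Ev n} {vb : Ev m}

/-- Adjoint as a real continuous linear map. -/
def adjL (n m : ℕ) : (Ev n →L[ℝ] Ev m) →L[ℝ] (Ev m →L[ℝ] Ev n) :=
  LinearMap.mkContinuous
    { toFun := fun T => ContinuousLinearMap.adjoint T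
      map_add' := fun a b => map_add _ a b
      map_smul' := fun c a => by simp } 1 (fun T => by simp)

lemma adjD_diff (hPhi : ContDiffAt ℝ 2 Φ xb) : DifferentiableAt ℝ (adjD Φ) xb := by
  have h1 : ContDiffAt ℝ 1 (fderiv ℝ Φ) xb := hPhi.fderiv_right (by norm_num)
  exact (adjL n m).differentiableAt.comp xb (h1.differentiableAt (by norm_num))

lemma psi_diff (hf : ContDiffAt ℝ 1 f xb) (hPhi : ContDiffAt ℝ 2 Φ xb) :
    HasFDerivAt (fun x => Psi f Φ x vb) (gradxPsi f Φ xb vb) xb := by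
  apply DifferentiableAt.hasFDerivAt
  exact (hf.differentiableAt (by norm_num)).add
    ((adjD_diff hPhi).clm_apply (differentiableAt_const vb))

lemma psi_decomp (x : Ev n) (v : Ev m) : Psi f Φ x v =
    Psi f Φ x vb + (adjD Φ x - adjD Φ xb) (v - vb) + adjD Φ xb (v - vb) := by
  simp only [Psi, map_sub, ContinuousLinearMap.sub_apply]
  abel

lemma bound_of_diff {E F : Type*} [NormedAddCommGroup E] [NormedSpace ℝ E] [NormedAddCommGroup F]
    [NormedSpace ℝ F] {G : E → F} {x : E} (h : DifferentiableAt ℝ G x) :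
    ∃ L : ℝ, 0 ≤ L ∧ ∀ᶠ y in 𝓝 x, ‖G y - G x‖ ≤ L * ‖y - x‖ := by
  obtain ⟨L, hL, h2⟩ := h.hasFDerivAt.isBigO_sub.exists_nonneg
  exact ⟨L, hL, h2.bound⟩

lemma backward (hf : ContDiffAt ℝ 1 f xb) (hPhi : ContDiffAt ℝ 2 Φ xb)
    (hvb : vb ∈ Lam f Φ θ xb) (ε c : ℝ) (hε : 0 < ε) (hc : 0 ≤ c)
    (H : ∀ x : Ev n, ∀ v : Ev m, ‖((x, v) : Ev n × Ev m) - (xb, vb)‖ ≤ ε →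
          ENNReal.ofReal (‖x - xb‖ + Metric.infDist v (Lam f Φ θ xb)) ≤
            ENNReal.ofReal c *
              (ENNReal.ofReal ‖Psi f Φ x v‖ +
                EMetric.infEdist (Φ x) {z : Ev m | v ∈ θ.subdiff z})) :
    ¬ IsCritical f Φ θ xb vb := by
  rintro ⟨ξ, hξ, w, hw, heq⟩
  have hmem : (Φ xb, vb) ∈ θ.gph := hvb.2
  have hseq := fun k : ℕ => tcone_seq hmem hw (1 / ((k : ℝ) + 1)) (by positivity)
  choose t ht0 htk q hq hqk using hseq
  have hu : Tendsto (fun k : ℕ => 1 / ((k : ℝ) + 1)) atTop (𝓝 0) :=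
    tendsto_one_div_add_atTop_nhds_zero_nat
  have ht : Tendsto t atTop (𝓝 0) :=
    squeeze_zero (fun k => (ht0 k).le) (fun k => (htk k).le) hu
  have hql : Tendsto (fun k => (t k)⁻¹ • (q k - (Φ xb, vb))) atTop (𝓝 (fderiv ℝ Φ xb ξ, w)) := by
    rw [tendsto_iff_norm_sub_tendsto_zero]
    exact squeeze_zero (fun k => norm_nonneg _) (fun k => (hqk k).le) hu
  have hqt : Tendsto q atTop (𝓝 (Φ xb, vb)) := by
    have h1 := (ht.smul hql).add_const (Φ xb, vb)
    simp only [zero_smul, zero_add] at h1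
    refine h1.congr fun k => ?_
    rw [smul_inv_smul₀ (ht0 k).ne', sub_add_cancel]
  have hz : Tendsto (fun k => (t k)⁻¹ • ((q k).1 - Φ xb)) atTop (𝓝 (fderiv ℝ Φ xb ξ)) :=
    (continuous_fst.tendsto _).comp hql
  have hv : Tendsto (fun k => (t k)⁻¹ • ((q k).2 - vb)) atTop (𝓝 w) :=
    (continuous_snd.tendsto _).comp hql
  have hvt : Tendsto (fun k => (q k).2) atTop (𝓝 vb) := (continuous_snd.tendsto _).comp hqt
  set x : ℕ → Ev n := fun k => xb + t k • ξ with hx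
  have hxt : Tendsto x atTop (𝓝 xb) := by
    have := (ht.smul_const ξ).const_add xb
    simpa using this
  have hxc : Tendsto (fun k => (t k)⁻¹ • (x k - xb)) atTop (𝓝 ξ) := by
    refine tendsto_const_nhds.congr fun k => ?_
    simp [hx, inv_smul_smul₀ (ht0 k).ne']
  have hΦd : HasFDerivAt Φ (fderiv ℝ Φ xb) xb :=
    (hPhi.differentiableAt (by norm_num)).hasFDerivAt
  have hΦl := fd_lim hΦd hxt hxc
  have hdz : Tendsto (fun k => (t k)⁻¹ • (Φ (x k) - (q k).1)) atTop (𝓝 0) := by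
    have := hΦl.sub hz
    rw [sub_self] at this
    refine this.congr fun k => ?_
    rw [← smul_sub]; congr 1; abel
  have hGl := fd_lim (psi_diff (vb := vb) hf hPhi) hxt hxc
  have hadj : Tendsto (fun k => adjD Φ (x k) - adjD Φ xb) atTop (𝓝 0) := by
    have := ((adjD_diff hPhi).continuousAt.tendsto.comp hxt).sub_const (adjD Φ xb)
    simpa using this
  have hP : Tendsto (fun k => (t k)⁻¹ • Psi f Φ (x k) (q k).2) atTop (𝓝 0) := by
    have hcl : Tendsto (fun k => (adjD Φ (x k) - adjD Φ xb) ((t k)⁻¹ • ((q k).2 - vb))) atTop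
        (𝓝 ((0 : Ev m →L[ℝ] Ev n) w)) :=
      clm_lim hadj hv
    have h1 := (hGl.add hcl).add (((adjD Φ xb).continuous.tendsto w).comp hv)
    simp only [ContinuousLinearMap.zero_apply, add_zero, heq] at h1
    refine h1.congr fun k => ?_
    have h0 : Psi f Φ xb vb = 0 := hvb.1
    rw [psi_decomp (vb := vb) (xb := xb) (x k) (q k).2, h0]
    simp only [Function.comp, map_smul, smul_add, sub_zero]
  have hsum : Tendsto (fun k => c * (‖(t k)⁻¹ • Psi f Φ (x k) (q k).2‖ +
      ‖(t k)⁻¹ • (Φ (x k) - (q k).1)‖)) atTop (𝓝 0) := by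
    simpa using (hP.norm.add hdz.norm).const_mul c
  have hnear : ∀ᶠ k in atTop, ‖((x k, (q k).2) : Ev n × Ev m) - (xb, vb)‖ ≤ ε := by
    have := ((hxt.prodMk_nhds hvt).sub_const (xb, vb)).norm
    rw [sub_self, norm_zero] at this
    exact (this.eventually (gt_mem_nhds hε)).mono fun k h => h.le
  obtain ⟨k, h1, h2⟩ := (hnear.and (hsum.eventually (gt_mem_nhds (norm_pos_iff.2 hξ)))).exists
  have h3 := H (x k) (q k).2 h1
  have h4 : EMetric.infEdist (Φ (x k)) {z : Ev m | (q k).2 ∈ θ.subdiff z} ≤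
      ENNReal.ofReal ‖Φ (x k) - (q k).1‖ := by
    rw [← dist_eq_norm, ← edist_dist]
    exact Metric.infEDist_le_edist_of_mem (hq k)
  have h5 : ENNReal.ofReal (‖x k - xb‖ + Metric.infDist (q k).2 (Lam f Φ θ xb)) ≤
      ENNReal.ofReal (c * (‖Psi f Φ (x k) (q k).2‖ + ‖Φ (x k) - (q k).1‖)) := by
    rw [ENNReal.ofReal_mul hc, ENNReal.ofReal_add (norm_nonneg _) (norm_nonneg _)]
    refine h3.trans ?_
    gcongr
  rw [ENNReal.ofReal_le_ofReal_iff (by positivity)] at h5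
  have h6 : 0 ≤ Metric.infDist (q k).2 (Lam f Φ θ xb) := Metric.infDist_nonneg
  have h7 : ‖x k - xb‖ = t k * ‖ξ‖ := by
    simp [hx, norm_smul, abs_of_pos (ht0 k)]
  rw [norm_smul, norm_smul, norm_inv, Real.norm_of_nonneg (ht0 k).le, ← mul_add,
    mul_left_comm, inv_mul_lt_iff₀ (ht0 k)] at h2
  linarith

lemma forward_aux (hf : ContDiffAt ℝ 1 f xb) (hPhi : ContDiffAt ℝ 2 Φ xb)
    (hvb : vb ∈ Lam f Φ θ xb)
    (H : ¬ ∃ ε : ℝ, 0 < ε ∧ ∃ c : ℝ, 0 ≤ c ∧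
        ∀ x : Ev n, ∀ v : Ev m, ‖((x, v) : Ev n × Ev m) - (xb, vb)‖ ≤ ε →
          ENNReal.ofReal (‖x - xb‖ + Metric.infDist v (Lam f Φ θ xb)) ≤
            ENNReal.ofReal c *
              (ENNReal.ofReal ‖Psi f Φ x v‖ +
                EMetric.infEdist (Φ x) {z : Ev m | v ∈ θ.subdiff z})) :
    ∃ D : ℝ, ∀ η : ℝ, 0 < η → ∃ (x : Ev n) (v z u : Ev m), 0 < ‖x - xb‖ ∧ ‖x - xb‖ ≤ η ∧
      ‖v - vb‖ ≤ η ∧ u ∈ θ.subdiff z ∧ ‖Psi f Φ x v‖ ≤ η * ‖x - xb‖ ∧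
      ‖Φ x - z‖ ≤ η * ‖x - xb‖ ∧ adjD Φ xb u = adjD Φ xb v ∧ ‖u - vb‖ ≤ D * ‖x - xb‖ := by
  obtain ⟨C, hC0, hC⟩ := θ.sel (adjD Φ xb)
  obtain ⟨L₁, hL₁, hB₁⟩ := bound_of_diff (psi_diff (vb := vb) hf hPhi).differentiableAt
  obtain ⟨L₂, hL₂, hB₂⟩ := bound_of_diff (adjD_diff hPhi)
  have hΨ0 : Psi f Φ xb vb = 0 := hvb.1
  set D₀ : ℝ := 2 * (1 + C * (L₁ + L₂)) with hD₀
  have hD₀p : 0 < D₀ := by positivity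
  refine ⟨C * (D₀ + (L₁ + L₂)), fun η hη => ?_⟩
  obtain ⟨ρ₁, hρ₁, hR₁⟩ := Metric.eventually_nhds_iff.1 (θ.subdiff_osc (Φ xb))
  obtain ⟨ρ₂, hρ₂, hR₂⟩ := Metric.eventually_nhds_iff.1 (θ.subdiff_stable vb)
  have hΦc : ∀ᶠ x in 𝓝 xb, dist (Φ x) (Φ xb) < ρ₁ / 2 :=
    hPhi.continuousAt.eventually (Metric.ball_mem_nhds _ (by positivity))
  obtain ⟨ρ₃, hρ₃, hR₃⟩ := Metric.eventually_nhds_iff.1 ((hB₁.and hB₂).and hΦc)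
  set ε : ℝ := min (min (η) (ρ₁ / 8)) (min (ρ₂ / 2) (min (ρ₃ / 2) 1)) with hε
  have hεp : 0 < ε := by positivity
  have hε1 : ε ≤ η := (min_le_left _ _).trans (min_le_left _ _)
  have hε2 : ε ≤ ρ₁ / 8 := (min_le_left _ _).trans (min_le_right _ _)
  have hε3 : ε ≤ ρ₂ / 2 := (min_le_right _ _).trans (min_le_left _ _)
  have hε4 : ε ≤ ρ₃ / 2 := (min_le_right _ _).trans ((min_le_right _ _).trans (min_le_left _ _))
  have hε5 : ε ≤ 1 := (min_le_right _ _).trans ((min_le_right _ _).trans (min_le_right _ _))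
  set c : ℝ := 2 * C + 1 + D₀ / η with hc
  have hcη : 0 ≤ D₀ / η := by positivity
  have hcp : 0 < c := by positivity
  have hc1 : 1 ≤ c := by linarith
  push Not at H
  obtain ⟨x, v, hxv, hlt⟩ := H ε hεp c hcp.le
  obtain ⟨z, hz, hzlt⟩ := enn_aux _ _ _ _ _ hcp (norm_nonneg _) hlt
  have hz : v ∈ θ.subdiff z := hz
  have hx : ‖x - xb‖ ≤ ε := (norm_fst_le (((x, v) : Ev n × Ev m) - (xb, vb))).trans hxv
  have hv : ‖v - vb‖ ≤ ε := (norm_snd_le (((x, v) : Ev n × Ev m) - (xb, vb))).trans hxv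
  obtain ⟨⟨hb1, hb2⟩, hb3⟩ := hR₃ (show dist x xb < ρ₃ by rw [dist_eq_norm]; linarith)
  set t := ‖x - xb‖ with ht
  set p := ‖Psi f Φ x v‖ with hp
  set e := ‖Φ x - z‖ with he
  set dd := Metric.infDist v (Lam f Φ θ xb) with hdd
  have hp0 : 0 ≤ p := norm_nonneg _
  have he0 : 0 ≤ e := norm_nonneg _
  have ht0 : 0 ≤ t := norm_nonneg _
  have hdv : dd ≤ ‖v - vb‖ := by
    rw [← dist_eq_norm]
    exact Metric.infDist_le_dist_of_mem hvb
  have hpe : p + e ≤ c * (p + e) := by nlinarith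
  have hzb : dist z (Φ xb) < ρ₁ := by
    have h1 : dist z (Φ x) = e := by rw [he, dist_eq_norm']
    have := dist_triangle z (Φ x) (Φ xb)
    linarith
  have hvzb : v ∈ θ.subdiff (Φ xb) := by
    rcases hR₁ hzb with h | h
    · exact h hz
    · exact absurd hvb.2.1 h
  have hvbz : vb ∈ θ.subdiff z :=
    hR₂ (show dist v vb < ρ₂ by rw [dist_eq_norm]; linarith) z hz
  have hA : ‖adjD Φ xb (v - vb)‖ ≤ p + (L₁ + L₂) * t := by
    have h1 : adjD Φ xb (v - vb) = Psi f Φ x v - (Psi f Φ x vb - Psi f Φ xb vb) -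
        (adjD Φ x - adjD Φ xb) (v - vb) := by
      rw [psi_decomp (vb := vb) (xb := xb) x v, hΨ0]; abel
    have h2 : ‖(adjD Φ x - adjD Φ xb) (v - vb)‖ ≤ L₂ * t := by
      refine ((adjD Φ x - adjD Φ xb).le_opNorm _).trans ?_
      calc _ ≤ (L₂ * t) * 1 := by
            gcongr
            linarith
        _ = _ := mul_one _
    rw [h1]
    refine (norm_sub_le _ _).trans ?_
    have h3 := norm_sub_le (Psi f Φ x v) (Psi f Φ x vb - Psi f Φ xb vb)
    linarith
  have hdd2 : dd ≤ C * (p + (L₁ + L₂) * t) := by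
    obtain ⟨u, hu, hAu, hun⟩ := hC (Φ xb) vb hvb.2 v hvzb
    have huL : u ∈ Lam f Φ θ xb := by
      refine ⟨?_, hu⟩
      rw [← hΨ0]
      simp only [Psi, hAu]
    calc dd ≤ dist v u := Metric.infDist_le_dist_of_mem huL
      _ = ‖u - v‖ := by rw [dist_eq_norm']
      _ ≤ C * ‖adjD Φ xb (vb - v)‖ := hun
      _ = C * ‖adjD Φ xb (v - vb)‖ := by rw [← neg_sub, map_neg, norm_neg]
      _ ≤ _ := by gcongr
  have hCp : 2 * (C * p) ≤ t + dd := by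
    have : 2 * C * p ≤ c * (p + e) := by gcongr <;> linarith
    linarith
  have hs : t + dd ≤ D₀ * t := by
    rw [hD₀]
    nlinarith
  have htp : 0 < t := by
    have h1 : 0 < t + dd := lt_of_le_of_lt (by positivity) hzlt
    by_contra! h
    have h2 : t = 0 := le_antisymm h ht0
    rw [h2, mul_zero] at hs
    rw [h2] at h1
    linarith
  have hpeη : p + e ≤ η * t := by
    have h1 : D₀ / η * (p + e) ≤ c * (p + e) := by gcongr; linarith
    have h2 : D₀ / η * (p + e) ≤ D₀ * t := by linarith
    rw [div_mul_eq_mul_div, div_le_iff₀ hη, mul_assoc D₀] at h2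
    have := le_of_mul_le_mul_left h2 hD₀p
    linarith
  obtain ⟨u, hu, hAu, hun⟩ := hC z v hz vb hvbz
  refine ⟨x, v, z, u, htp, hx.trans hε1, hv.trans hε1, hu, by linarith, by linarith, hAu, ?_⟩
  refine hun.trans ?_
  rw [mul_assoc]
  gcongr
  linarith

lemma forward (hf : ContDiffAt ℝ 1 f xb) (hPhi : ContDiffAt ℝ 2 Φ xb)
    (hvb : vb ∈ Lam f Φ θ xb) (D : ℝ)
    (H : ∀ η : ℝ, 0 < η → ∃ (x : Ev n) (v z u : Ev m), 0 < ‖x - xb‖ ∧ ‖x - xb‖ ≤ η ∧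
      ‖v - vb‖ ≤ η ∧ u ∈ θ.subdiff z ∧ ‖Psi f Φ x v‖ ≤ η * ‖x - xb‖ ∧
      ‖Φ x - z‖ ≤ η * ‖x - xb‖ ∧ adjD Φ xb u = adjD Φ xb v ∧ ‖u - vb‖ ≤ D * ‖x - xb‖) :
    IsCritical f Φ θ xb vb := by
  have H' := fun k : ℕ => H (1 / ((k : ℝ) + 1)) (by positivity)
  choose x v z u ht hx hv hu hP hz hA hub using H'
  have hη : Tendsto (fun k : ℕ => 1 / ((k : ℝ) + 1)) atTop (𝓝 0) :=
    tendsto_one_div_add_atTop_nhds_zero_nat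
  set t : ℕ → ℝ := fun k => ‖x k - xb‖ with htdef
  have hin : ∀ k : ℕ, (((t k)⁻¹ • (x k - xb), (t k)⁻¹ • (u k - vb)) : Ev n × Ev m) ∈
      Metric.sphere (0 : Ev n) 1 ×ˢ Metric.closedBall (0 : Ev m) D := by
    intro k
    refine ⟨?_, ?_⟩
    · simp only [mem_sphere_zero_iff_norm]
      rw [norm_smul, norm_inv, Real.norm_of_nonneg (ht k).le]
      exact inv_mul_cancel₀ (ht k).ne'
    · simp only [mem_closedBall_zero_iff]
      rw [norm_smul, norm_inv, Real.norm_of_nonneg (ht k).le, inv_mul_le_iff₀ (ht k)]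
      linarith [hub k]
  obtain ⟨⟨ξ, w⟩, hmem, φ, hφ, hlim⟩ :=
    ((isCompact_sphere (0 : Ev n) 1).prod (isCompact_closedBall (0 : Ev m) D)).tendsto_subseq hin
  have hφt := hφ.tendsto_atTop
  have hηφ := hη.comp hφt
  have hξ : ‖ξ‖ = 1 := by simpa using hmem.1
  have hxl : Tendsto (fun k => (t (φ k))⁻¹ • (x (φ k) - xb)) atTop (𝓝 ξ) :=
    (continuous_fst.tendsto _).comp hlim
  have hul : Tendsto (fun k => (t (φ k))⁻¹ • (u (φ k) - vb)) atTop (𝓝 w) :=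
    (continuous_snd.tendsto _).comp hlim
  have ht0 : Tendsto (fun k => t (φ k)) atTop (𝓝 0) :=
    squeeze_zero (fun k => (ht _).le) (fun k => hx _) hηφ
  have hxt : Tendsto (fun k => x (φ k)) atTop (𝓝 xb) :=
    tendsto_iff_norm_sub_tendsto_zero.2 ht0
  have hvt : Tendsto (fun k => v (φ k) - vb) atTop (𝓝 0) :=
    squeeze_zero_norm (fun k => hv _) hηφ
  have hsm : ∀ {E : Type} [NormedAddCommGroup E] [NormedSpace ℝ E] (g : ℕ → E),
      (∀ k : ℕ, ‖g k‖ ≤ 1 / ((k : ℝ) + 1) * t k) →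
      Tendsto (fun k => (t (φ k))⁻¹ • g (φ k)) atTop (𝓝 0) := by
    intro E _ _ g hg
    refine squeeze_zero_norm (fun k => ?_) hηφ
    rw [norm_smul, norm_inv, Real.norm_of_nonneg (ht _).le, inv_mul_le_iff₀ (ht _), mul_comm]
    exact hg _
  have hPl := hsm (fun k => Psi f Φ (x k) (v k)) hP
  have hzl := hsm (fun k => Φ (x k) - z k) hz
  have hΦd : HasFDerivAt Φ (fderiv ℝ Φ xb) xb :=
    (hPhi.differentiableAt (by norm_num)).hasFDerivAt
  have hΦl := fd_lim hΦd hxt hxl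
  have hz2 : Tendsto (fun k => (t (φ k))⁻¹ • (z (φ k) - Φ xb)) atTop (𝓝 (fderiv ℝ Φ xb ξ)) := by
    have := hΦl.sub hzl
    rw [sub_zero] at this
    refine this.congr fun k => ?_
    rw [← smul_sub]; congr 1; abel
  have hback : ∀ {E : Type} [NormedAddCommGroup E] [NormedSpace ℝ E] (g : ℕ → E) (a l : E),
      Tendsto (fun k => (t (φ k))⁻¹ • (g k - a)) atTop (𝓝 l) → Tendsto g atTop (𝓝 a) := by
    intro E _ _ g a l h
    have h1 := (ht0.smul h).add_const a
    simp only [zero_smul, zero_add] at h1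
    refine h1.congr fun k => ?_
    rw [smul_inv_smul₀ (ht _).ne', sub_add_cancel]
  refine ⟨ξ, fun h => by simp [h] at hξ, w, ?_, ?_⟩
  · exact ⟨fun k => (z (φ k), u (φ k)), fun k => (t (φ k))⁻¹, fun k => hu _,
      fun k => inv_nonneg.2 (ht _).le,
      (hback _ _ _ hz2).prodMk_nhds (hback _ _ _ hul), hz2.prodMk_nhds hul⟩
  · have hGl := fd_lim (psi_diff (vb := vb) hf hPhi) hxt hxl
    obtain ⟨L₂, hL₂, hB₂⟩ := bound_of_diff (adjD_diff hPhi)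
    have hq : Tendsto (fun k => (t (φ k))⁻¹ •
        ((adjD Φ (x (φ k)) - adjD Φ xb) (v (φ k) - vb))) atTop (𝓝 0) := by
      have h1 : Tendsto (fun k => L₂ * ‖v (φ k) - vb‖) atTop (𝓝 0) := by
        simpa using hvt.norm.const_mul L₂
      refine squeeze_zero_norm' ?_ h1
      filter_upwards [hxt.eventually hB₂] with k hk
      rw [norm_smul, norm_inv, Real.norm_of_nonneg (ht _).le, inv_mul_le_iff₀ (ht _)]
      refine ((adjD Φ (x (φ k)) - adjD Φ xb).le_opNorm _).trans ?_
      calc _ ≤ (L₂ * t (φ k)) * ‖v (φ k) - vb‖ := by gcongr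
        _ = _ := by ring
    have hAl := ((adjD Φ xb).continuous.tendsto w).comp hul
    have hsum := (hGl.add hq).add hAl
    rw [add_zero] at hsum
    refine tendsto_nhds_unique hsum (hPl.congr fun k => ?_)
    have h0 : Psi f Φ xb vb = 0 := hvb.1
    rw [psi_decomp (vb := vb) (xb := xb) (x (φ k)) (v (φ k)), h0]
    simp only [Function.comp, map_smul, map_sub, hA, smul_add, sub_zero]

end Main

/-- noncriticality is equivalent to a local error bound, where the distance
to `(∂θ)⁻¹(v)` is taken in `ℝ≥0∞` (distance to the empty set is `+∞`). -/
theorem stmt7 {n m : ℕ} (θ : CPWL m) (f : Ev n → Ev n) (Φ : Ev n → Ev m)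
    (xb : Ev n) (vb : Ev m)
    (hf : ContDiffAt ℝ 1 f xb) (hPhi : ContDiffAt ℝ 2 Φ xb)
    (hvb : vb ∈ Lam f Φ θ xb) :
    ¬ IsCritical f Φ θ xb vb ↔
      ∃ ε : ℝ, 0 < ε ∧ ∃ c : ℝ, 0 ≤ c ∧
        ∀ x : Ev n, ∀ v : Ev m, ‖((x, v) : Ev n × Ev m) - (xb, vb)‖ ≤ ε →
          ENNReal.ofReal (‖x - xb‖ + Metric.infDist v (Lam f Φ θ xb)) ≤
            ENNReal.ofReal c *
              (ENNReal.ofReal ‖Psi f Φ x v‖ +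
                EMetric.infEdist (Φ x) {z : Ev m | v ∈ θ.subdiff z}) := by

  constructor
  · intro hnc
    by_contra H
    obtain ⟨D, hD⟩ := forward_aux hf hPhi hvb H
    exact hnc (forward hf hPhi hvb D hD)
  · rintro ⟨ε, hε, c, hc, H⟩
    exact backward hf hPhi hvb ε c hε hc H
end
end
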